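/- Let X be a finite set with #X ≥ 2. For every nontrivial w ∈ TS', the stabilizer Stab(w) of w in Aut F(X) is exactly the subgroup generated by the inner automorphism x ↦ w⁻¹xw (right-conjugation by w), and this subgroup is infinite cyclic. -/

import Mathlib

/-! Common definitions: cyclic length, Whitehead automorphisms, the sets TS, TS', L(ε),
balls, and exponential genericity in the free group F(X). -/

/-- The cyclic length ‖w‖_X : the minimum of |g w g⁻¹|_X over g ∈ F(X). -/
noncomputable def cyclicLength {X : Type} [DecidableEq X] (w : FreeGroup X) : ℕ :=
  sInf (Set.range fun g : FreeGroup X => FreeGroup.norm (g * w * g⁻¹))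

/-- w is cyclically reduced if |w|_X = ‖w‖_X. -/
def CyclicallyReduced {X : Type} [DecidableEq X] (w : FreeGroup X) : Prop :=
  FreeGroup.norm w = cyclicLength w

/-- The set X^± = X ∪ X⁻¹ of letters, viewed inside F(X). -/
def Xpm (X : Type) : Set (FreeGroup X) :=
  (Set.range fun x : X => FreeGroup.of x) ∪ (Set.range fun x : X => (FreeGroup.of x)⁻¹)

/-- σ is a type I (relabeling) Whitehead automorphism: there is a bijection π of X^±
commuting with inversion such that σ(x) = π(x) for all x ∈ X. -/
def IsTypeI {X : Type} (σ : MulAut (FreeGroup X)) : Prop :=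
  ∃ π : FreeGroup X → FreeGroup X,
    Set.BijOn π (Xpm X) (Xpm X) ∧
    (∀ x ∈ Xpm X, π x⁻¹ = (π x)⁻¹) ∧
    (∀ x : X, σ (FreeGroup.of x) = π (FreeGroup.of x))

/-- σ is a type II Whitehead automorphism: there is a ∈ X^± with σ(a) = a and
σ(x) ∈ {x, xa, a⁻¹x, a⁻¹xa} for every x ∈ X^±. -/
def IsTypeII {X : Type} (σ : MulAut (FreeGroup X)) : Prop :=
  ∃ a ∈ Xpm X, σ a = a ∧
    ∀ x ∈ Xpm X, σ x = x ∨ σ x = x * a ∨ σ x = a⁻¹ * x ∨ σ x = a⁻¹ * x * a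

/-- σ is inner if it is conjugation by some element of F(X). -/
def IsInnerAut {X : Type} (σ : MulAut (FreeGroup X)) : Prop :=
  ∃ g : FreeGroup X, σ = MulAut.conj g

/-- w is a proper power if w = z^r for some z and some integer r ≥ 2. -/
def IsProperPower {X : Type} (w : FreeGroup X) : Prop :=
  ∃ z : FreeGroup X, ∃ r : ℕ, 2 ≤ r ∧ w = z ^ r

/-- TS is the set of cyclically reduced w that are not proper powers, whose cyclic length
is strictly increased by every non-inner type II Whitehead automorphism, and whose
conjugacy class is fixed by no non-identity type I Whitehead automorphism. -/
def TS (X : Type) [DecidableEq X] : Set (FreeGroup X) :=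
  {w | CyclicallyReduced w ∧ ¬ IsProperPower w ∧
    (∀ τ : MulAut (FreeGroup X), IsTypeII τ → ¬ IsInnerAut τ →
      cyclicLength w < cyclicLength (τ w)) ∧
    (∀ σ : MulAut (FreeGroup X), IsTypeI σ → σ ≠ 1 → ¬ IsConj w (σ w))}

/-- The set of elements of F(X) whose cyclic reduction lies in S. -/
def cyclicPreimage {X : Type} [DecidableEq X] (S : Set (FreeGroup X)) : Set (FreeGroup X) :=
  {w | ∃ g u : FreeGroup X, u ∈ S ∧ CyclicallyReduced u ∧ w = g * u * g⁻¹ ∧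
    FreeGroup.norm w = 2 * FreeGroup.norm g + FreeGroup.norm u}

/-- TS' is the set of elements of F(X) whose cyclic reduction lies in TS. -/
def TS' (X : Type) [DecidableEq X] : Set (FreeGroup X) :=
  cyclicPreimage (TS X)

/-- The ball B_n = {w ∈ F(X) : |w|_X ≤ n}. -/
def ballF (X : Type) [DecidableEq X] (n : ℕ) : Set (FreeGroup X) :=
  {w | FreeGroup.norm w ≤ n}

/-- S is exponentially T-generic: there are C > 0 and s ∈ (0,1) with
#((T∖S) ∩ B_n) ≤ C·s^n·#(T ∩ B_n) for all n. -/
def ExpGeneric {X : Type} [DecidableEq X] (S T : Set (FreeGroup X)) : Prop :=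
  ∃ C : ℝ, 0 < C ∧ ∃ s : ℝ, 0 < s ∧ s < 1 ∧
    ∀ n : ℕ, (((T \ S) ∩ ballF X n).ncard : ℝ) ≤ C * s ^ n * ((T ∩ ballF X n).ncard : ℝ)

/-- L(ε): the set of cyclically reduced w of length n ≥ 1 all of whose one-letter
frequencies lie in (1/(2N) − ε, 1/(2N) + ε) and all of whose cyclic two-letter
frequencies (for y ≠ x⁻¹) lie in (1/(2N(2N−1)) − ε, 1/(2N(2N−1)) + ε). -/
def Lset (X : Type) [Fintype X] [DecidableEq X] (ε : ℝ) : Set (FreeGroup X) :=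
  {w | CyclicallyReduced w ∧ 1 ≤ FreeGroup.norm w ∧
    ∀ x y : X × Bool, y ≠ (x.1, !x.2) →
      |((w.toWord.count x : ℝ) / (FreeGroup.norm w : ℝ)) -
        1 / (2 * (Fintype.card X : ℝ))| < ε ∧
      |(((w.toWord.zip (w.toWord.rotate 1)).count (x, y) : ℝ) / (FreeGroup.norm w : ℝ)) -
        1 / (2 * (Fintype.card X : ℝ) * (2 * (Fintype.card X : ℝ) - 1))| < ε}

namespace FreeGroup

section Letters

variable {X : Type*}

/-- The inverse of a letter. -/
def bar (z : X × Bool) : X × Bool := (z.1, !z.2)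

/-- A letter, viewed as an element of the free group. -/
def letter (z : X × Bool) : FreeGroup X := mk [z]

@[simp] theorem bar_bar (z : X × Bool) : bar (bar z) = z := by simp [bar]

theorem bar_ne (z : X × Bool) : bar z ≠ z := by
  rcases z with ⟨x, b⟩; cases b <;> simp [bar]

theorem bar_injective : Function.Injective (bar (X := X)) :=
  fun a b h => by rw [← bar_bar a, h, bar_bar]

theorem bar_eq_iff {a b : X × Bool} : bar a = b ↔ a = bar b :=
  ⟨fun h => by rw [← h, bar_bar], fun h => by rw [h, bar_bar]⟩

@[simp] theorem letter_bar (z : X × Bool) : letter (bar z) = (letter z)⁻¹ := by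
  simp [letter, bar, inv_mk, invRev]

variable [DecidableEq X]

theorem startsWith_unique {g : FreeGroup X} {a b : X × Bool} (ha : g ∈ startsWith a)
    (hb : g ∈ startsWith b) : a = b := by
  simp only [startsWith, Set.mem_ofPred_eq] at ha hb
  exact Option.some.inj (ha.symm.trans hb)

theorem one_notMem_startsWith (z : X × Bool) : (1 : FreeGroup X) ∉ startsWith z :=
  fun h => startsWith.ne_one _ h rfl

theorem exists_startsWith {g : FreeGroup X} (hg : g ≠ 1) : ∃ z, g ∈ startsWith z := by
  have h : g.toWord ≠ [] := fun h => hg (toWord_eq_nil_iff.1 h)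
  obtain ⟨z, l, hl⟩ := List.exists_cons_of_ne_nil h
  exact ⟨z, by simp [startsWith, hl]⟩

theorem toWord_letter_mul {g : FreeGroup X} {z : X × Bool} (h : g ∉ startsWith (bar z)) :
    (letter z * g).toWord = z :: g.toWord := by
  have h1 : reduce (z :: g.toWord) = z :: g.toWord := by
    rw [reduce.cons, reduce_toWord]
    cases hw : g.toWord with
    | nil => rfl
    | cons a l =>
      simp only [startsWith, Set.mem_ofPred_eq, hw, bar] at h
      simp only [List.getElem?_cons_zero, Option.some.injEq] at h
      simp only
      rw [if_neg]
      rintro ⟨h1, h2⟩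
      apply h
      ext <;> simp [h1, h2]
  rw [toWord_mul, letter, toWord_mk, reduce_singleton, List.singleton_append, h1]

theorem norm_letter_mul {g : FreeGroup X} {z : X × Bool} (h : g ∉ startsWith (bar z)) :
    norm (letter z * g) = norm g + 1 := by
  simp [norm, toWord_letter_mul h]

theorem letter_mul_mem {g : FreeGroup X} {z : X × Bool} (h : g ∉ startsWith (bar z)) :
    letter z * g ∈ startsWith z := by
  simp [startsWith, toWord_letter_mul h]

theorem letter_mul_mem_iff_eq {g : FreeGroup X} {z a : X × Bool} (h : g ∉ startsWith (bar z)) :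
    letter z * g ∈ startsWith a ↔ a = z :=
  ⟨fun h' => startsWith_unique h' (letter_mul_mem h), fun e => by subst e; exact letter_mul_mem h⟩

theorem inv_letter_mul_notMem {g : FreeGroup X} {z : X × Bool} (h : g ∈ startsWith z) :
    (letter z)⁻¹ * g ∉ startsWith (bar z) := by
  have hw : ∃ l, g.toWord = z :: l := by
    simp only [startsWith, Set.mem_ofPred_eq] at h
    cases hw : g.toWord with
    | nil => simp [hw] at h
    | cons a l => exact ⟨l, by simp_all⟩
  obtain ⟨l, hl⟩ := hw
  have hr : IsReduced (z :: l) := hl ▸ isReduced_toWord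
  have hg : g = letter z * mk l := by
    rw [← mk_toWord (x := g), hl, letter, mul_mk]; rfl
  rw [hg, inv_mul_cancel_left]
  have hl' : IsReduced l := List.IsChain.tail hr
  simp only [startsWith, Set.mem_ofPred_eq, toWord_mk, hl'.reduce_eq]
  cases l with
  | nil => simp
  | cons a l =>
    have := (isReduced_cons_cons.1 hr).1
    simp only [List.getElem?_cons_zero, Option.some.injEq]
    rintro rfl
    simp [bar] at this

theorem letter_mul_mem_iff {g : FreeGroup X} {z : X × Bool} :
    letter z * g ∈ startsWith z ↔ g ∉ startsWith (bar z) :=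
  ⟨fun h => by simpa using inv_letter_mul_notMem h, letter_mul_mem⟩

theorem inv_letter_mul_mem_iff {g : FreeGroup X} {z : X × Bool} :
    (letter z)⁻¹ * g ∈ startsWith (bar z) ↔ g ∉ startsWith z := by
  rw [← letter_bar, letter_mul_mem_iff, bar_bar]

@[simp] theorem letter_mem_iff {z a : X × Bool} : letter z ∈ startsWith a ↔ a = z := by
  have := letter_mul_mem_iff_eq (a := a) (one_notMem_startsWith (bar z))
  rwa [mul_one] at this

@[simp] theorem inv_letter_mem_iff {z a : X × Bool} :
    (letter z)⁻¹ ∈ startsWith a ↔ a = bar z := by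
  rw [← letter_bar, letter_mem_iff]

theorem letter_injective : Function.Injective (letter (X := X)) := fun a b h => by
  have : letter a ∈ startsWith a := by simp
  rw [h] at this
  simpa using this

theorem letter_ne_one (z : X × Bool) : letter z ≠ 1 := fun h => by
  have : letter z ∈ startsWith z := by simp
  exact startsWith.ne_one _ this h

@[elab_as_elim]
theorem reduced_induction {p : FreeGroup X → Prop} (one : p 1)
    (mul : ∀ z g, g ∉ startsWith (bar z) → p g → p (letter z * g)) (g : FreeGroup X) : p g := by
  induction h : norm g generalizing g with
  | zero => rwa [norm_eq_zero.1 h]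
  | succ n ih =>
    have hg : g ≠ 1 := by rintro rfl; simp at h
    obtain ⟨z, hz⟩ := exists_startsWith hg
    have h1 := inv_letter_mul_notMem hz
    have h2 := norm_letter_mul h1
    rw [mul_inv_cancel_left] at h2
    have h3 := mul z _ h1 (ih _ (by omega))
    rwa [mul_inv_cancel_left] at h3

/-- Right multiplication by a letter changes the first letter only at the ends of one edge. -/
theorem mul_letter_mem_iff {h : FreeGroup X} {y z : X × Bool} (h1 : h = 1 → y ≠ z)
    (h2 : h = letter z → y ≠ bar z) : h * letter y ∈ startsWith z ↔ h ∈ startsWith z := by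
  induction h using reduced_induction generalizing z with
  | one =>
    have := h1 rfl
    simp [one_notMem_startsWith, this.symm]
  | mul x h hx ih =>
    by_cases h3 : h * letter y ∈ startsWith (bar x)
    · have h4 : h = 1 ∧ y = bar x := by
        by_contra hc
        refine hx ((ih (fun e e' => hc ⟨e, e'⟩) ?_).1 h3)
        rintro rfl
        simp at hx
      obtain ⟨rfl, rfl⟩ := h4
      rw [mul_one, letter_bar, mul_inv_cancel, letter_mem_iff]
      refine iff_of_false (one_notMem_startsWith z) ?_
      rintro rfl
      exact h2 (by simp) rfl
    · rw [mul_assoc, letter_mul_mem_iff_eq h3, letter_mul_mem_iff_eq hx]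

theorem startsWith_mul_letter {h : FreeGroup X} {y z : X × Bool} :
    ¬ (h ∈ startsWith z ↔ h * letter y ∈ startsWith z) ↔
      (h = 1 ∧ z = y) ∨ (h = letter z ∧ z = bar y) := by
  constructor
  · intro hc
    by_contra! h'
    exact hc (mul_letter_mem_iff (fun e e' => h'.1 e e'.symm)
      (fun e e' => h'.2 e (bar_eq_iff.1 e'.symm).symm.symm)).symm
  · rintro (⟨rfl, rfl⟩ | ⟨rfl, rfl⟩)
    · simp [one_notMem_startsWith]
    · simp [one_notMem_startsWith]

/-- If the product `g * u` does not cancel the first letter of `u` completely, the first letter of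
`g` survives. -/
theorem mul_mem_startsWith {g u : FreeGroup X} {b c : X × Bool} (hu : u ∈ startsWith b)
    (hb : g⁻¹ ∉ startsWith b) (hg : g ∈ startsWith c) : g * u ∈ startsWith c := by
  induction g using reduced_induction generalizing c with
  | one => exact absurd hg (one_notMem_startsWith c)
  | mul x g hx ih =>
    rw [letter_mul_mem_iff_eq hx] at hg
    subst hg
    rw [mul_assoc, letter_mul_mem_iff]
    intro hc
    by_cases h1 : g = 1
    · subst h1
      rw [one_mul] at hc
      have := startsWith_unique hu hc
      subst this
      simp at hb
    · obtain ⟨d, hd⟩ := exists_startsWith h1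
      have hb' : g⁻¹ ∉ startsWith b := by
        rw [mul_inv_rev, ← letter_bar, mul_letter_mem_iff] at hb
        · exact hb
        · intro e; exact absurd (inv_eq_one.1 e) h1
        · intro e e'
          rw [inv_eq_iff_eq_inv, ← letter_bar, ← e'] at e
          simp [e] at hx
      have := startsWith_unique (ih hb' hd) hc
      subst this
      exact hx hd

theorem norm_mul_letter {g : FreeGroup X} {z : X × Bool} (h : g⁻¹ ∉ startsWith z) :
    norm (g * letter z) = norm g + 1 := by
  rw [← norm_inv_eq, mul_inv_rev, ← letter_bar, norm_letter_mul (by rwa [bar_bar]), norm_inv_eq]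

theorem norm_mul_of_forall {u v : FreeGroup X}
    (h : ∀ z, u⁻¹ ∈ startsWith z → v ∉ startsWith z) : norm (u * v) = norm u + norm v := by
  induction u using reduced_induction with
  | one => simp
  | mul x u hx ih =>
    by_cases hv : v = 1
    · simp [hv]
    obtain ⟨b, hb⟩ := exists_startsWith hv
    have hux : (letter x * u)⁻¹ ∉ startsWith b := fun h' => h b h' hb
    have h1 : u * v ∉ startsWith (bar x) := by
      intro h1
      have := mul_mem_startsWith hb hux (letter_mul_mem hx)
      rw [mul_assoc, letter_mul_mem_iff] at this
      exact this h1
    rw [mul_assoc, norm_letter_mul h1, norm_letter_mul hx, ih]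
    · omega
    · intro z hz hz'
      obtain rfl := startsWith_unique hb hz'
      apply hux
      rw [mul_inv_rev, ← letter_bar, mul_letter_mem_iff]
      · exact hz
      · intro e; exact absurd (e ▸ hz) (one_notMem_startsWith _)
      · intro e e'
        rw [inv_eq_iff_eq_inv, ← letter_bar] at e
        simp [e, ← e'] at hx

end Letters

end FreeGroup

section Ends

open Filter Set

variable {G : Type*} [Group G]

/-- A subset of a group is almost invariant if every right translate differs from it by a finite
set. -/
def AlmostInvariant (A : Set G) : Prop :=
  ∀ u : G, {h | ¬ (h ∈ A ↔ h * u ∈ A)}.Finite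

/-- The image of a set under the affine bijection `h ↦ k * β h`. -/
def affineImage (k : G) (β : MulAut G) (A : Set G) : Set G :=
  {h | β⁻¹ (k⁻¹ * h) ∈ A}

/-- The image of a set of pairs under the affine bijection `h ↦ k * β h` of the first component. -/
def affineEnds (k : G) (β : MulAut G) (S : Set (G × Bool)) : Set (G × Bool) :=
  {p | (β⁻¹ (k⁻¹ * p.1), p.2) ∈ S}

/-- A pair `(g, true)` stands for the limit of `g * w ^ i` for `i → ∞`, a pair `(g, false)` for the
limit for `i → -∞`. This is the set of such ends lying in the closure of `A`. -/
def ends (w : G) (A : Set G) : Set (G × Bool) :=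
  {p | ∀ᶠ i : ℤ in (bif p.2 then atTop else atBot), p.1 * w ^ i ∈ A}

/-- The line `g ⟨w⟩`. -/
def line (w g : G) : Set G := Set.range fun i : ℤ => g * w ^ i

/-- The lines with one end in `P` and the other one in `Q`. -/
def linesBetween (w : G) (P Q : Set (G × Bool)) : Set (Set G) :=
  line w '' {g | ((g, true) ∈ P ∧ (g, false) ∈ Q) ∨ ((g, true) ∈ Q ∧ (g, false) ∈ P)}

namespace AlmostInvariant

variable {A B : Set G}

theorem compl (hA : AlmostInvariant A) : AlmostInvariant Aᶜ := fun u => by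
  simpa only [mem_compl_iff, not_iff_not] using hA u

theorem inter (hA : AlmostInvariant A) (hB : AlmostInvariant B) : AlmostInvariant (A ∩ B) :=
  fun u => ((hA u).union (hB u)).subset fun h hh => by
    simp only [mem_ofPred_eq, mem_inter_iff, mem_union] at hh ⊢
    tauto

theorem union (hA : AlmostInvariant A) (hB : AlmostInvariant B) : AlmostInvariant (A ∪ B) :=
  fun u => ((hA u).union (hB u)).subset fun h hh => by
    simp only [mem_ofPred_eq, mem_union] at hh ⊢
    tauto

theorem empty : AlmostInvariant (∅ : Set G) := fun u => by simp

theorem biUnion {ι : Type*} (s : Finset ι) {A : ι → Set G} (hA : ∀ i, AlmostInvariant (A i)) :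
    AlmostInvariant (⋃ i ∈ s, A i) := by
  classical
  induction s using Finset.induction_on with
  | empty => simpa using empty
  | insert a s _ ih => rw [Finset.set_biUnion_insert]; exact (hA a).union ih

theorem affineImage (hA : AlmostInvariant A) (k : G) (β : MulAut G) :
    AlmostInvariant (affineImage k β A) := fun u => by
  have hinj : Function.Injective fun h : G => β⁻¹ (k⁻¹ * h) :=
    (β⁻¹ : MulAut G).injective.comp (mul_right_injective k⁻¹)
  refine ((hA (β⁻¹ u)).preimage (f := fun h : G => β⁻¹ (k⁻¹ * h)) hinj.injOn).subset ?_
  intro h hh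
  simpa only [_root_.affineImage, mem_ofPred_eq, mem_preimage, ← map_mul, mul_assoc] using hh

end AlmostInvariant

section affine

variable (k l : G) (β γ : MulAut G) (S T : Set (G × Bool))

theorem mem_affineEnds {p : G × Bool} : p ∈ affineEnds k β S ↔ (β⁻¹ (k⁻¹ * p.1), p.2) ∈ S := Iff.rfl

theorem affineEnds_affineEnds :
    affineEnds k β (affineEnds l γ S) = affineEnds (k * β l) (β * γ) S := by
  ext p
  simp [mem_affineEnds, mul_assoc]

@[simp] theorem affineEnds_one_one : affineEnds 1 1 S = S := by
  ext p; simp [mem_affineEnds]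

theorem affineEnds_compl : affineEnds k β Sᶜ = (affineEnds k β S)ᶜ := rfl

theorem affineEnds_inter : affineEnds k β (S ∩ T) = affineEnds k β S ∩ affineEnds k β T := rfl

variable {S T} in
theorem affineEnds_mono (h : S ⊆ T) : affineEnds k β S ⊆ affineEnds k β T := fun _ hp => h hp

theorem affineEnds_inverse :
    affineEnds (β⁻¹ k⁻¹) β⁻¹ (affineEnds k β S) = S := by
  rw [affineEnds_affineEnds]; simp

variable {S T} in
theorem affineEnds_subset_iff : affineEnds k β S ⊆ affineEnds k β T ↔ S ⊆ T := by
  refine ⟨fun h => ?_, affineEnds_mono k β⟩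
  have := affineEnds_mono (β⁻¹ k⁻¹) β⁻¹ h
  rwa [affineEnds_inverse, affineEnds_inverse] at this

variable {S} in
theorem affineEnds_nonempty_iff : (affineEnds k β S).Nonempty ↔ S.Nonempty := by
  constructor
  · rintro ⟨p, hp⟩; exact ⟨_, hp⟩
  · rintro ⟨p, hp⟩
    exact ⟨(k * β p.1, p.2), by simpa [mem_affineEnds] using hp⟩

end affine

variable {w : G} {A B : Set G}

theorem ends_inter : ends w (A ∩ B) = ends w A ∩ ends w B := by
  ext p; exact eventually_and

theorem ends_mono (h : A ⊆ B) : ends w A ⊆ ends w B := fun _ hp => hp.mono fun _ hi => h hi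

theorem ends_empty : ends w (∅ : Set G) = ∅ := by
  ext ⟨g, b⟩
  cases b <;> simp [ends, NeBot.ne]

theorem mul_zpow_injective (hw : Function.Injective fun i : ℤ => w ^ i) (g : G) :
    Function.Injective fun i : ℤ => g * w ^ i :=
  (mul_right_injective g).comp hw

theorem ends_congr (hw : Function.Injective fun i : ℤ => w ^ i)
    (h : {x | ¬ (x ∈ A ↔ x ∈ B)}.Finite) : ends w A = ends w B := by
  ext ⟨g, b⟩
  have h1 : ∀ᶠ i : ℤ in cofinite, (g * w ^ i ∈ A ↔ g * w ^ i ∈ B) := by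
    rw [eventually_cofinite]
    exact h.preimage (mul_zpow_injective hw g).injOn
  refine eventually_congr (h1.filter_mono ?_)
  cases b
  · exact atBot_le_cofinite
  · exact atTop_le_cofinite

theorem ends_compl (hw : Function.Injective fun i : ℤ => w ^ i) (hA : AlmostInvariant A) :
    ends w Aᶜ = (ends w A)ᶜ := by
  ext ⟨g, b⟩
  have h1 : {i : ℤ | ¬ (g * w ^ i ∈ A ↔ g * w ^ (i + 1) ∈ A)}.Finite := by
    refine ((hA w).preimage (mul_zpow_injective hw g).injOn).subset fun i hi => ?_
    simpa [mul_assoc, ← zpow_add_one] using hi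
  obtain ⟨M, hM⟩ := h1.bddAbove
  obtain ⟨m, hm⟩ := h1.bddBelow
  cases b
  · simp only [ends, mem_ofPred_eq, cond_false, mem_compl_iff]
    have key : ∀ i ≤ m - 1, (g * w ^ i ∈ A ↔ g * w ^ (m - 1) ∈ A) := by
      refine fun i hi => Int.leInductionDown (m := m - 1)
        (motive := fun i _ => (g * w ^ i ∈ A ↔ g * w ^ (m - 1) ∈ A)) Iff.rfl ?_ i hi
      intro n hn ih
      rw [← ih]
      by_contra hc
      have := hm (show n - 1 ∈ _ by simpa using hc)
      omega
    constructor
    · intro h h'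
      obtain ⟨i, h1, h2⟩ := (h.and h').exists
      exact h1 h2
    · intro h
      filter_upwards [eventually_le_atBot (m - 1)] with i hi hiA
      refine h ?_
      filter_upwards [eventually_le_atBot (m - 1)] with j hj
      rwa [key j hj, ← key i hi]
  · simp only [ends, mem_ofPred_eq, cond_true, mem_compl_iff]
    have key : ∀ i ≥ M + 1, (g * w ^ i ∈ A ↔ g * w ^ (M + 1) ∈ A) := by
      refine fun i hi => Int.leInduction (m := M + 1)
        (motive := fun i _ => (g * w ^ i ∈ A ↔ g * w ^ (M + 1) ∈ A)) Iff.rfl ?_ i hi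
      intro n hn ih
      rw [← ih]
      by_contra hc
      have := hM (show n ∈ _ by rwa [mem_ofPred_eq, iff_comm])
      omega
    constructor
    · intro h h'
      obtain ⟨i, h1, h2⟩ := (h.and h').exists
      exact h1 h2
    · intro h
      filter_upwards [eventually_ge_atTop (M + 1)] with i hi hiA
      refine h ?_
      filter_upwards [eventually_ge_atTop (M + 1)] with j hj
      rwa [key j hj, ← key i hi]

theorem ends_union (hw : Function.Injective fun i : ℤ => w ^ i) (hA : AlmostInvariant A)
    (hB : AlmostInvariant B) : ends w (A ∪ B) = ends w A ∪ ends w B := by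
  apply compl_injective
  rw [← ends_compl hw (hA.union hB), compl_union, compl_union, ends_inter, ends_compl hw hA,
    ends_compl hw hB]

theorem ends_biUnion (hw : Function.Injective fun i : ℤ => w ^ i) {ι : Type*} (s : Finset ι)
    {A : ι → Set G} (hA : ∀ i, AlmostInvariant (A i)) :
    ends w (⋃ i ∈ s, A i) = ⋃ i ∈ s, ends w (A i) := by
  classical
  induction s using Finset.induction_on with
  | empty => simpa using ends_empty
  | insert a s _ ih =>
    rw [Finset.set_biUnion_insert, ends_union hw (hA a) (AlmostInvariant.biUnion s hA), ih,
      Finset.set_biUnion_insert]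

theorem ends_affineImage (k : G) (β : MulAut G) :
    ends (β w) (affineImage k β A) = affineEnds k β (ends w A) := by
  ext ⟨g, b⟩
  simp [ends, affineImage, affineEnds, ← map_zpow, ← mul_assoc]

theorem ends_mul_right (hw : Function.Injective fun i : ℤ => w ^ i) (hA : AlmostInvariant A)
    (k : G) : ends w {h | h * k ∈ A} = ends w A :=
  (ends_congr hw (hA k)).symm

/-- Membership of ends is constant along lines. -/
def LineInvariant (w : G) (S : Set (G × Bool)) : Prop :=
  ∀ g b (j : ℤ), (g * w ^ j, b) ∈ S ↔ (g, b) ∈ S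

theorem lineInvariant_ends (w : G) (A : Set G) : LineInvariant w (ends w A) := by
  intro g b j
  simp only [ends, mem_ofPred_eq, mul_assoc, ← zpow_add]
  cases b
  · simp only [cond_false]
    have h1 := eventually_map (f := (atBot : Filter ℤ)) (m := fun i => j + i)
      (P := fun i => g * w ^ i ∈ A)
    rw [← h1, show map (fun i => j + i) atBot = (atBot : Filter ℤ) from
      (OrderIso.addLeft j).map_atBot]
  · simp only [cond_true]
    have h1 := eventually_map (f := (atTop : Filter ℤ)) (m := fun i => j + i)
      (P := fun i => g * w ^ i ∈ A)
    rw [← h1, show map (fun i => j + i) atTop = (atTop : Filter ℤ) from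
      (OrderIso.addLeft j).map_atTop]

theorem line_eq_line_iff {g h : G} : line w g = line w h ↔ ∃ i : ℤ, h = g * w ^ i := by
  constructor
  · intro e
    have : h ∈ line w g := e ▸ ⟨0, by simp⟩
    obtain ⟨i, hi⟩ := this
    exact ⟨i, hi.symm⟩
  · rintro ⟨i, rfl⟩
    ext x
    constructor
    · rintro ⟨j, rfl⟩
      exact ⟨j - i, by simp [mul_assoc, ← zpow_add]⟩
    · rintro ⟨j, rfl⟩
      exact ⟨i + j, by simp [mul_assoc, ← zpow_add]⟩

theorem linesBetween_mono {P P' Q Q' : Set (G × Bool)} (hP : P ⊆ P') (hQ : Q ⊆ Q') :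
    linesBetween w P Q ⊆ linesBetween w P' Q' :=
  image_mono fun _ h => h.imp (fun h => ⟨hP h.1, hQ h.2⟩) (fun h => ⟨hQ h.1, hP h.2⟩)

theorem linesBetween_comm (P Q : Set (G × Bool)) : linesBetween w P Q = linesBetween w Q P := by
  simp only [linesBetween, or_comm]

theorem image_line (k : G) (β : MulAut G) (g : G) :
    (fun h => k * β h) '' line w g = line (β w) (k * β g) := by
  simp [line, ← range_comp, Function.comp_def, mul_assoc]

theorem linesBetween_affineEnds (k : G) (β : MulAut G) (P Q : Set (G × Bool)) :
    linesBetween (β w) (affineEnds k β P) (affineEnds k β Q) =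
      Set.image (fun h => k * β h) '' linesBetween w P Q := by
  ext L
  simp only [linesBetween, mem_image, exists_exists_and_eq_and, image_line]
  constructor
  · rintro ⟨g, hg, rfl⟩
    exact ⟨β⁻¹ (k⁻¹ * g), hg, by simp⟩
  · rintro ⟨g, hg, rfl⟩
    refine ⟨k * β g, ?_, rfl⟩
    simpa [mem_affineEnds] using hg

theorem ncard_linesBetween_affineEnds (k : G) (β : MulAut G) (P Q : Set (G × Bool)) :
    (linesBetween (β w) (affineEnds k β P) (affineEnds k β Q)).ncard =
      (linesBetween w P Q).ncard := by
  rw [linesBetween_affineEnds]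
  exact ncard_image_of_injective _
    (image_injective.2 ((mul_right_injective k).comp β.injective))

theorem linesBetween_compl_subset (hw : Function.Injective fun i : ℤ => w ^ i)
    (hA : AlmostInvariant A) :
    linesBetween w (ends w A) (ends w A)ᶜ ⊆ line w '' {h | ¬ (h ∈ A ↔ h * w ∈ A)} := by
  rintro _ ⟨g, hg, rfl⟩
  by_contra hc
  have h1 : ∀ i : ℤ, (g * w ^ (i + 1) ∈ A ↔ g * w ^ i ∈ A) := by
    intro i
    by_contra h2
    refine hc ⟨g * w ^ i, ?_, (line_eq_line_iff.2 ⟨i, rfl⟩).symm⟩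
    rw [mem_ofPred_eq, mul_assoc, ← zpow_add_one]
    tauto
  have h2 : ∀ i : ℤ, (g * w ^ i ∈ A ↔ g ∈ A) := by
    intro i
    induction i with
    | zero => simp
    | succ i ih => rw [h1, ih]
    | pred i ih => rw [← ih, ← h1]; simp
  rw [← ends_compl hw hA] at hg
  simp only [ends, mem_ofPred_eq, mem_compl_iff, h2, cond_true, cond_false] at hg
  simp only [eventually_atTop, eventually_atBot] at hg
  rcases hg with ⟨⟨a, ha⟩, b, hb⟩ | ⟨⟨a, ha⟩, b, hb⟩
  · exact hb b le_rfl (ha a le_rfl)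
  · exact ha a le_rfl (hb b le_rfl)

theorem finite_linesBetween_compl (hw : Function.Injective fun i : ℤ => w ^ i)
    (hA : AlmostInvariant A) : (linesBetween w (ends w A) (ends w A)ᶜ).Finite :=
  ((hA w).image _).subset (linesBetween_compl_subset hw hA)

/-- The number of lines separated by `S`. -/
noncomputable def weight (w : G) (S : Set (G × Bool)) : ℕ := (linesBetween w S Sᶜ).ncard

theorem weight_compl (S : Set (G × Bool)) : weight w Sᶜ = weight w S := by
  rw [weight, weight, compl_compl, linesBetween_comm]

theorem weight_affineEnds (k : G) (β : MulAut G) (S : Set (G × Bool)) :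
    weight (β w) (affineEnds k β S) = weight w S :=
  ncard_linesBetween_affineEnds k β S Sᶜ

theorem weight_translate (k : G) (S : Set (G × Bool)) :
    weight w (affineEnds k 1 S) = weight w S :=
  weight_affineEnds k 1 S

theorem weight_inter_le {S T : Set (G × Bool)} (hS : LineInvariant w S) (hT : LineInvariant w T)
    (hfinS : (linesBetween w S Sᶜ).Finite) (hfin : (linesBetween w T Tᶜ).Finite)
    (h : (linesBetween w (S ∩ T) (Sᶜ ∩ T)).ncard ≤ (linesBetween w (Sᶜ ∩ T) (Sᶜ ∩ Tᶜ)).ncard) :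
    weight w (S ∩ T) ≤ weight w T := by
  have h1 : linesBetween w (S ∩ T) (S ∩ T)ᶜ ⊆
      linesBetween w (S ∩ T) (Sᶜ ∩ T) ∪ linesBetween w (S ∩ T) Tᶜ := by
    rintro _ ⟨g, hg, rfl⟩
    by_cases hc : ((g, true) ∈ Tᶜ ∨ (g, false) ∈ Tᶜ)
    · refine Or.inr ⟨g, ?_, rfl⟩
      simp only [mem_ofPred_eq, mem_inter_iff, mem_compl_iff] at hg hc ⊢
      tauto
    · refine Or.inl ⟨g, ?_, rfl⟩
      simp only [mem_ofPred_eq, mem_inter_iff, mem_compl_iff] at hg hc ⊢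
      tauto
  have h2 : linesBetween w (Sᶜ ∩ T) Tᶜ ∪ linesBetween w (S ∩ T) Tᶜ ⊆ linesBetween w T Tᶜ :=
    union_subset (linesBetween_mono inter_subset_right Subset.rfl)
      (linesBetween_mono inter_subset_right Subset.rfl)
  have h3 : Disjoint (linesBetween w (Sᶜ ∩ T) Tᶜ) (linesBetween w (S ∩ T) Tᶜ) := by
    rw [Set.disjoint_left]
    rintro _ ⟨g, hg, rfl⟩ ⟨g', hg', e⟩
    obtain ⟨i, rfl⟩ := line_eq_line_iff.1 e
    simp only [mem_ofPred_eq, mem_inter_iff, mem_compl_iff, hS g' _ i, hT g' _ i] at hg hg'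
    tauto
  have hfin2 := hfin.subset h2
  calc weight w (S ∩ T)
      ≤ (linesBetween w (S ∩ T) (Sᶜ ∩ T) ∪ linesBetween w (S ∩ T) Tᶜ).ncard := by
        exact ncard_le_ncard h1 ((hfinS.subset (linesBetween_mono inter_subset_left
          inter_subset_left)).union (hfin2.subset subset_union_right))
    _ ≤ (linesBetween w (S ∩ T) (Sᶜ ∩ T)).ncard + (linesBetween w (S ∩ T) Tᶜ).ncard :=
        ncard_union_le _ _
    _ ≤ (linesBetween w (Sᶜ ∩ T) Tᶜ).ncard + (linesBetween w (S ∩ T) Tᶜ).ncard := by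
        exact Nat.add_le_add_right (h.trans (ncard_le_ncard
          (linesBetween_mono Subset.rfl inter_subset_right)
          (hfin2.subset subset_union_left))) _
    _ = (linesBetween w (Sᶜ ∩ T) Tᶜ ∪ linesBetween w (S ∩ T) Tᶜ).ncard :=
        (ncard_union_eq h3 (hfin2.subset subset_union_left)
          (hfin2.subset subset_union_right)).symm
    _ ≤ weight w T := ncard_le_ncard h2 hfin

end Ends

/-- Two subsets cross if all four corners are nonempty. -/
def Cross {α : Type*} (A B : Set α) : Prop :=
  (A ∩ B).Nonempty ∧ (A ∩ Bᶜ).Nonempty ∧ (Aᶜ ∩ B).Nonempty ∧ (Aᶜ ∩ Bᶜ).Nonempty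

section Cross

variable {α : Type*} {A B : Set α}

theorem Cross.symm (h : Cross A B) : Cross B A := by
  unfold Cross at *
  rw [Set.inter_comm B A, Set.inter_comm B Aᶜ, Set.inter_comm Bᶜ A, Set.inter_comm Bᶜ Aᶜ]
  tauto

theorem cross_compl_left : Cross Aᶜ B ↔ Cross A B := by
  unfold Cross
  rw [compl_compl]
  tauto

theorem cross_compl_right : Cross A Bᶜ ↔ Cross A B := by
  unfold Cross
  rw [compl_compl]
  tauto

theorem not_cross_of_subset (h : A ⊆ B) : ¬ Cross A B := fun hc => by
  obtain ⟨x, hx, hx'⟩ := hc.2.1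
  exact hx' (h hx)

theorem not_cross_of_disjoint (h : Disjoint A B) : ¬ Cross A B := fun hc => by
  obtain ⟨x, hx, hx'⟩ := hc.1
  exact Set.disjoint_left.1 h hx hx'

theorem cross_affineEnds {G : Type*} [Group G] (k : G) (β : MulAut G) {S T : Set (G × Bool)} :
    Cross (affineEnds k β S) (affineEnds k β T) ↔ Cross S T := by
  simp only [Cross, ← affineEnds_compl, ← affineEnds_inter, affineEnds_nonempty_iff]

end Cross

namespace FreeGroup

section Branch

variable {X : Type*} [DecidableEq X]

theorem almostInvariant_of_letter {A : Set (FreeGroup X)}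
    (h : ∀ y, {g | ¬ (g ∈ A ↔ g * letter y ∈ A)}.Finite) : AlmostInvariant A := fun u => by
  induction u using reduced_induction with
  | one => simp
  | mul z g _ ih =>
    refine ((h z).union (ih.preimage (mul_left_injective (letter z)).injOn)).subset ?_
    intro x hx
    simp only [Set.mem_ofPred_eq, Set.mem_union, Set.mem_preimage, ← mul_assoc] at hx ⊢
    tauto

theorem almostInvariant_startsWith (z : X × Bool) : AlmostInvariant (startsWith z) :=
  almostInvariant_of_letter fun y => by
    refine (Set.toFinite {1, letter z}).subset fun g hg => ?_
    rw [Set.mem_ofPred_eq, startsWith_mul_letter] at hg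
    simp only [Set.mem_insert_iff, Set.mem_singleton_iff]
    tauto

/-- The ends of the cone of all reduced words starting with `z`. -/
def branch (w : FreeGroup X) (z : X × Bool) : Set (FreeGroup X × Bool) := ends w (startsWith z)

theorem affineImage_bar (z : X × Bool) :
    affineImage (letter z) 1 (startsWith (bar z)) = (startsWith z)ᶜ := by
  ext h
  simp only [affineImage, inv_one, MulAut.one_apply, Set.mem_ofPred_eq, Set.mem_compl_iff]
  exact inv_letter_mul_mem_iff

omit [DecidableEq X] in
theorem affineEnds_ends (w k : FreeGroup X) (A : Set (FreeGroup X)) :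
    affineEnds k 1 (ends w A) = ends w (affineImage k 1 A) :=
  (ends_affineImage (w := w) k 1).symm

theorem translate_startsWith_subset {p : FreeGroup X} {c z : X × Bool}
    (hp : p⁻¹ ∉ startsWith z) (hc : p ∈ startsWith c) :
    affineImage p 1 (startsWith z) ⊆ startsWith c := fun h hh => by
  simp only [affineImage, inv_one, MulAut.one_apply, Set.mem_ofPred_eq] at hh
  simpa using mul_mem_startsWith hh hp hc

variable {w : FreeGroup X}

theorem translate_branch_subset {p : FreeGroup X} {c z : X × Bool}
    (hp : p⁻¹ ∉ startsWith z) (hc : p ∈ startsWith c) :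
    affineEnds p 1 (branch w z) ⊆ branch w c := by
  rw [branch, affineEnds_ends]
  exact ends_mono (translate_startsWith_subset hp hc)

theorem disjoint_branch {a b : X × Bool} (hab : a ≠ b) :
    Disjoint (branch w a) (branch w b) := by
  rw [Set.disjoint_iff_inter_eq_empty, branch, branch, ← ends_inter, ← ends_empty (w := w)]
  congr 1
  rw [← Set.disjoint_iff_inter_eq_empty, Set.disjoint_left]
  exact fun g h1 h2 => hab (startsWith_unique h1 h2)

theorem lineInvariant_branch (z : X × Bool) : LineInvariant w (branch w z) :=
  lineInvariant_ends _ _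

variable (hw : Function.Injective fun i : ℤ => w ^ i)
include hw

theorem translate_bar (z : X × Bool) :
    affineEnds (letter z) 1 (branch w (bar z)) = (branch w z)ᶜ := by
  rw [branch, branch, affineEnds_ends, affineImage_bar, ends_compl hw (almostInvariant_startsWith z)]

theorem translate_compl_bar (z : X × Bool) :
    affineEnds (letter z) 1 (branch w (bar z))ᶜ = branch w z := by
  rw [affineEnds_compl, translate_bar hw, compl_compl]

theorem translate_subset {y z : X × Bool} (h : z ≠ bar y) :
    affineEnds (letter y) 1 (branch w z) ⊆ branch w y := by
  conv_rhs => rw [← translate_compl_bar hw]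
  exact affineEnds_mono _ _ (Set.subset_compl_iff_disjoint_right.2 (disjoint_branch h))

theorem finite_linesBetween_branch (z : X × Bool) :
    (linesBetween w (branch w z) (branch w z)ᶜ).Finite :=
  finite_linesBetween_compl hw (almostInvariant_startsWith z)

theorem weight_branch_bar (z : X × Bool) : weight w (branch w (bar z)) = weight w (branch w z) := by
  rw [← weight_compl (branch w z), ← translate_bar hw, weight_translate]

variable [Finite X]

omit hw [Finite X] in
theorem biUnion_startsWith_compl (Z : Finset (X × Bool)) [Fintype X] :
    (⋃ z ∈ Z, startsWith z)ᶜ = (⋃ z ∈ Zᶜ, startsWith z) ∪ {(1 : FreeGroup X)} := by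
  ext g
  simp only [Set.mem_compl_iff, Set.mem_iUnion, not_exists, Set.mem_union, Set.mem_singleton_iff,
    Finset.mem_compl, exists_prop, not_and]
  constructor
  · intro h
    by_cases hg : g = 1
    · exact Or.inr hg
    · obtain ⟨z, hz⟩ := exists_startsWith hg
      exact Or.inl ⟨z, fun h' => h z h' hz, hz⟩
  · rintro (⟨z, hz, hg⟩ | rfl) a ha h
    · exact hz (startsWith_unique h hg ▸ ha)
    · exact one_notMem_startsWith a h

theorem exists_branch (p : FreeGroup X × Bool) : ∃ z, p ∈ branch w z := by
  cases nonempty_fintype X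
  have h1 : ends w (⋃ z ∈ (∅ : Finset (X × Bool)), startsWith z)ᶜ = Set.univ := by
    rw [ends_compl hw (AlmostInvariant.biUnion _ almostInvariant_startsWith)]
    simp [ends_empty]
  have h2 : ends w (⋃ z ∈ (∅ : Finset (X × Bool)), startsWith z)ᶜ =
      ends w (⋃ z ∈ (∅ : Finset (X × Bool))ᶜ, startsWith z) := by
    rw [biUnion_startsWith_compl]
    refine ends_congr hw ((Set.finite_singleton 1).subset fun g hg => ?_)
    simp only [Set.mem_union, Set.mem_ofPred_eq, Set.mem_singleton_iff] at hg ⊢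
    tauto
  rw [ends_biUnion hw _ almostInvariant_startsWith, h1] at h2
  have h3 := h2 ▸ Set.mem_univ p
  simp only [Set.mem_iUnion] at h3
  obtain ⟨z, -, hz⟩ := h3
  exact ⟨z, hz⟩

/-- The union of the branches in a set of directions. -/
def branches (w : FreeGroup X) (Z : Set (X × Bool)) : Set (FreeGroup X × Bool) :=
  ⋃ z ∈ Z, branch w z

omit hw in
omit [Finite X] in
theorem mem_branches {Z : Set (X × Bool)} {p : FreeGroup X × Bool} :
    p ∈ branches w Z ↔ ∃ z ∈ Z, p ∈ branch w z := by
  simp [branches]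

theorem branches_compl (Z : Set (X × Bool)) : (branches w Z)ᶜ = branches w Zᶜ := by
  ext p
  obtain ⟨z, hz⟩ := exists_branch hw p
  have h : ∀ Y : Set (X × Bool), p ∈ branches w Y ↔ z ∈ Y := fun Y => by
    rw [mem_branches]
    refine ⟨?_, fun h => ⟨z, h, hz⟩⟩
    rintro ⟨y, hy, hpy⟩
    by_contra hc
    exact Set.disjoint_left.1 (disjoint_branch (w := w) (by rintro rfl; exact hc hy)) hpy hz
  rw [Set.mem_compl_iff, h, h, Set.mem_compl_iff]

omit hw [Finite X] in
theorem branches_singleton (z : X × Bool) : branches w {z} = branch w z := by simp [branches]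

omit [Finite X] in
theorem branches_eq_ends (Z : Finset (X × Bool)) :
    branches w Z = ends w (⋃ z ∈ Z, startsWith z) := by
  rw [ends_biUnion hw _ almostInvariant_startsWith]; rfl

theorem translate_branches (y : X × Bool) :
    affineEnds (letter y) 1 (branches w {bar y}ᶜ) = branch w y := by
  rw [← branches_compl hw, branches_singleton, translate_compl_bar hw]

theorem branch_nonempty [Nontrivial X] (z : X × Bool) : (branch w z).Nonempty := by
  obtain ⟨c, hc⟩ := exists_branch hw (1, true)
  have h1 : ∀ z, z ≠ bar c → (branch w z).Nonempty := fun z hz =>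
    (((affineEnds_nonempty_iff (letter z) 1).2 ⟨_, hc⟩).mono
      (translate_subset hw (y := z) fun h => hz (bar_eq_iff.2 h).symm))
  by_cases hz : z = bar c
  · obtain ⟨x, hx⟩ := exists_ne c.1
    have h2 := h1 (x, true) (by rintro h; exact hx (congrArg Prod.fst h))
    refine (((affineEnds_nonempty_iff (letter z) 1).2 h2).mono
      (translate_subset hw (y := z) ?_))
    rw [hz, bar_bar]
    rintro h; exact hx (congrArg Prod.fst h)
  · exact h1 z hz

theorem branches_subset_iff [Nontrivial X] {Y Z : Set (X × Bool)} :
    branches w Y ⊆ branches w Z ↔ Y ⊆ Z := by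
  constructor
  · intro h y hy
    obtain ⟨p, hp⟩ := branch_nonempty hw y
    obtain ⟨z, hz, hpz⟩ := mem_branches.1 (h (mem_branches.2 ⟨y, hy, hp⟩))
    by_contra hc
    exact Set.disjoint_left.1 (disjoint_branch (w := w) (by rintro rfl; exact hc hz)) hp hpz
  · intro h p hp
    obtain ⟨z, hz, hpz⟩ := mem_branches.1 hp
    exact mem_branches.2 ⟨z, h hz, hpz⟩

omit [Finite X] in
theorem exists_reduced (g : FreeGroup X) (z : X × Bool) : ∃ p z', p⁻¹ ∉ startsWith z' ∧
    (affineEnds g 1 (branch w z) = affineEnds p 1 (branch w z') ∨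
      affineEnds g 1 (branch w z) = (affineEnds p 1 (branch w z'))ᶜ) := by
  by_cases h : g⁻¹ ∈ startsWith z
  · refine ⟨g * letter z, bar z, ?_, Or.inr ?_⟩
    · rw [mul_inv_rev]
      exact inv_letter_mul_notMem h
    · rw [← translate_compl_bar hw z, affineEnds_affineEnds, ← affineEnds_compl]
      simp
  · exact ⟨g, z, h, Or.inl rfl⟩

omit [Finite X] in
theorem not_cross_translate (g h : FreeGroup X) (a b : X × Bool) :
    ¬ Cross (affineEnds g 1 (branch w a)) (affineEnds h 1 (branch w b)) := by
  rw [← cross_affineEnds h⁻¹ 1]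
  simp only [affineEnds_affineEnds, MulAut.one_apply, inv_mul_cancel, mul_one, affineEnds_one_one]
  obtain ⟨p, z, hp, he⟩ := exists_reduced hw (h⁻¹ * g) a
  have h1 : ¬ Cross (affineEnds p 1 (branch w z)) (branch w b) := by
    by_cases hp1 : p = 1
    · subst hp1
      rw [affineEnds_one_one]
      by_cases hzb : z = b
      · exact not_cross_of_subset (by rw [hzb])
      · exact not_cross_of_disjoint (disjoint_branch hzb)
    · obtain ⟨c, hc⟩ := exists_startsWith hp1
      by_cases hcb : c = b
      · exact not_cross_of_subset (hcb ▸ translate_branch_subset hp hc)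
      · exact not_cross_of_disjoint ((disjoint_branch hcb).mono_left (translate_branch_subset hp hc))
  rcases he with he | he
  · rwa [he]
  · rwa [he, cross_compl_left]

end Branch

section Deep

variable {X : Type*} [DecidableEq X] [Finite X] {A : Set (FreeGroup X)}

theorem finite_norm_le (n : ℕ) : {g : FreeGroup X | norm g ≤ n}.Finite :=
  (List.finite_length_le (X × Bool) n).preimage toWord_injective.injOn

omit [Finite X] in
theorem mem_iff_of_norm_lt {M : ℕ} (hM : ∀ h y, M < norm h → (h ∈ A ↔ h * letter y ∈ A))
    (v q : FreeGroup X) (hq : M < norm q) (h : ∀ c, q⁻¹ ∈ startsWith c → v ∉ startsWith c) :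
    q * v ∈ A ↔ q ∈ A := by
  induction v using reduced_induction generalizing q with
  | one => simp
  | mul c v hv ih =>
    have h1 : q⁻¹ ∉ startsWith c := fun h' => h c h' (letter_mul_mem hv)
    rw [← mul_assoc, ih (q * letter c) (by rw [norm_mul_letter h1]; omega), ← hM q c hq]
    intro d hd
    rw [mul_inv_rev, ← letter_bar, letter_mul_mem_iff_eq (by rwa [bar_bar])] at hd
    rwa [hd]

theorem exists_deep (hA : AlmostInvariant A) : ∃ M : ℕ, ∀ p z, M ≤ norm p → p⁻¹ ∉ startsWith z →
    affineImage p 1 (startsWith z) ⊆ A ∨ affineImage p 1 (startsWith z) ⊆ Aᶜ := by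
  have hfin : (⋃ y : X × Bool, {h | ¬ (h ∈ A ↔ h * letter y ∈ A)}).Finite :=
    Set.finite_iUnion fun y => hA _
  obtain ⟨M, hM⟩ := (hfin.image norm).bddAbove
  have hM' : ∀ h y, M < norm h → (h ∈ A ↔ h * letter y ∈ A) := fun h y hh => by
    by_contra hc
    exact absurd (hM ⟨h, Set.mem_iUnion.2 ⟨y, hc⟩, rfl⟩) (by omega)
  refine ⟨M, fun p z hp hz => ?_⟩
  have key : ∀ h ∈ affineImage p 1 (startsWith z), (h ∈ A ↔ p * letter z ∈ A) := by
    intro h hh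
    simp only [affineImage, inv_one, MulAut.one_apply, Set.mem_ofPred_eq] at hh
    have h1 := inv_letter_mul_notMem hh
    have h2 := mem_iff_of_norm_lt hM' ((letter z)⁻¹ * (p⁻¹ * h)) (p * letter z)
      (by rw [norm_mul_letter hz]; omega) ?_
    · rwa [show p * letter z * ((letter z)⁻¹ * (p⁻¹ * h)) = h by group] at h2
    · intro d hd
      rw [mul_inv_rev, ← letter_bar, letter_mul_mem_iff_eq (by rwa [bar_bar])] at hd
      rwa [hd]
  by_cases hc : p * letter z ∈ A
  · exact Or.inl fun h hh => (key h hh).2 hc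
  · exact Or.inr fun h hh => fun h' => hc ((key h hh).1 h')

variable {w : FreeGroup X} (hw : Function.Injective fun i : ℤ => w ^ i)
include hw

theorem exists_deep_branch (hA : AlmostInvariant A) : ∃ M : ℕ, ∀ p z, M ≤ norm p →
    p⁻¹ ∉ startsWith z → affineEnds p 1 (branch w z) ⊆ ends w A ∨
      affineEnds p 1 (branch w z) ⊆ (ends w A)ᶜ := by
  obtain ⟨M, hM⟩ := exists_deep hA
  refine ⟨M, fun p z hp hz => ?_⟩
  rw [branch, affineEnds_ends, ← ends_compl hw hA]
  exact (hM p z hp hz).imp ends_mono ends_mono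

theorem finite_of_ends_eq_empty [Nontrivial X] (hA : AlmostInvariant A) (h : ends w A = ∅) :
    A.Finite := by
  obtain ⟨M, hM⟩ := exists_deep hA
  refine (finite_norm_le M).subset fun g hg => ?_
  by_contra hc
  simp only [Set.mem_ofPred_eq, not_le] at hc
  have hg1 : g⁻¹ ≠ 1 := by
    rintro h
    rw [inv_eq_one] at h
    simp [h] at hc
  obtain ⟨z, hz⟩ := exists_startsWith hg1
  have h1 := inv_letter_mul_notMem hz
  have h2 : (g * letter z)⁻¹ ∉ startsWith (bar z) := by rwa [mul_inv_rev]
  have h3 : norm (g * letter z) + 1 = norm g := by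
    have := norm_mul_letter h2
    rw [← this]
    simp
  have h4 : g ∈ affineImage (g * letter z) 1 (startsWith (bar z)) := by
    simp [affineImage]
  rcases hM _ _ (by omega) h2 with h5 | h5
  · have h6 := ends_mono (w := w) h5
    rw [h, ← affineEnds_ends, Set.subset_empty_iff] at h6
    obtain ⟨p, hp⟩ := (affineEnds_nonempty_iff (g * letter z) 1).2 (branch_nonempty hw (bar z))
    exact (h6 ▸ hp : p ∈ (∅ : Set _))
  · exact h5 h4 hg

theorem finite_of_ends_eq [Nontrivial X] {B : Set (FreeGroup X)} (hA : AlmostInvariant A)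
    (hB : AlmostInvariant B) (h : ends w A = ends w B) : {g | ¬ (g ∈ A ↔ g ∈ B)}.Finite := by
  have h1 : (A ∩ Bᶜ).Finite := finite_of_ends_eq_empty hw (hA.inter hB.compl) (by
    rw [ends_inter, ends_compl hw hB, h, Set.inter_compl_self])
  have h2 : (B ∩ Aᶜ).Finite := finite_of_ends_eq_empty hw (hB.inter hA.compl) (by
    rw [ends_inter, ends_compl hw hA, h, Set.inter_compl_self])
  refine (h1.union h2).subset fun g hg => ?_
  simp only [Set.mem_ofPred_eq, Set.mem_union, Set.mem_inter_iff, Set.mem_compl_iff] at hg ⊢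
  tauto

end Deep

end FreeGroup

namespace FreeGroup

section Length

variable {X : Type*} [DecidableEq X]

/-- The edges of type `z` crossed by the path spelled by `u`, indexed by its starting point. -/
def crossings (z : X × Bool) (u : FreeGroup X) : Set (FreeGroup X) :=
  {h | ¬ (h ∈ startsWith z ↔ h * u ∈ startsWith z)}

theorem finite_crossings (z : X × Bool) (u : FreeGroup X) : (crossings z u).Finite :=
  almostInvariant_startsWith z u

omit [DecidableEq X] in
theorem ncard_preimage_mul_right (S : Set (FreeGroup X)) (u : FreeGroup X) :
    ((fun h => h * u) ⁻¹' S).ncard = S.ncard := by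
  have : (fun h => h * u) ⁻¹' S = (fun h => h * u⁻¹) '' S := by
    ext h
    simp
  rw [this]
  exact Set.ncard_image_of_injective _ (mul_left_injective _)

theorem crossings_mul_subset (z : X × Bool) (u v : FreeGroup X) :
    crossings z (u * v) ⊆ crossings z u ∪ (fun h => h * u) ⁻¹' crossings z v := fun h hh => by
  simp only [crossings, Set.mem_ofPred_eq, Set.mem_union, Set.mem_preimage, mul_assoc] at hh ⊢
  tauto

theorem finite_preimage_crossings (z : X × Bool) (u v : FreeGroup X) :
    ((fun h => h * u) ⁻¹' crossings z v).Finite :=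
  (finite_crossings z v).preimage (mul_left_injective u).injOn

theorem ncard_crossings_mul_le (z : X × Bool) (u v : FreeGroup X) :
    (crossings z (u * v)).ncard ≤ (crossings z u).ncard + (crossings z v).ncard := by
  rw [← ncard_preimage_mul_right (crossings z v) u]
  exact (Set.ncard_le_ncard (crossings_mul_subset z u v)
    ((finite_crossings z u).union (finite_preimage_crossings z u v))).trans (Set.ncard_union_le _ _)

theorem ncard_crossings_letter (z y : X × Bool) :
    (crossings z (letter y)).ncard = (if z = y then 1 else 0) + (if z = bar y then 1 else 0) := by
  have h : crossings z (letter y) = {g | (g = 1 ∧ z = y) ∨ (g = letter z ∧ z = bar y)} := by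
    ext g; exact startsWith_mul_letter
  rw [h]
  by_cases h1 : z = y
  · subst h1
    simp [(bar_ne z).symm]
  · by_cases h2 : z = bar y <;> simp [h1, h2]
    rw [← h2]; simp [h1]

theorem ncard_crossings_letter_mul (z y : X × Bool) {v : FreeGroup X} (hv : v ∉ startsWith (bar y)) :
    (crossings z (letter y * v)).ncard = (crossings z (letter y)).ncard + (crossings z v).ncard := by
  have hd : Disjoint (crossings z (letter y)) ((fun h => h * letter y) ⁻¹' crossings z v) := by
    rw [Set.disjoint_left]
    intro h h1 h2
    rw [crossings, Set.mem_ofPred_eq, startsWith_mul_letter] at h1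
    rcases h1 with ⟨rfl, rfl⟩ | ⟨rfl, rfl⟩
    · apply h2
      simp [letter_mul_mem hv]
    · apply h2
      simp [one_notMem_startsWith, hv]
  have he : crossings z (letter y * v) =
      crossings z (letter y) ∪ (fun h => h * letter y) ⁻¹' crossings z v := by
    ext h
    have : h ∈ crossings z (letter y) → h ∉ (fun h => h * letter y) ⁻¹' crossings z v :=
      fun h1 => Set.disjoint_left.1 hd h1
    simp only [crossings, Set.mem_ofPred_eq, Set.mem_union, Set.mem_preimage, mul_assoc] at this ⊢
    tauto
  rw [he, Set.ncard_union_eq hd (finite_crossings _ _) (finite_preimage_crossings _ _ _),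
    ncard_preimage_mul_right]

theorem sum_ncard_crossings [Fintype X] (u : FreeGroup X) :
    ∑ z, (crossings z u).ncard = 2 * norm u := by
  induction u using reduced_induction with
  | one => simp [crossings]
  | mul y v hv ih =>
    simp only [ncard_crossings_letter_mul _ y hv, ncard_crossings_letter, Finset.sum_add_distrib,
      ih, norm_letter_mul hv, Finset.sum_ite_eq', Finset.mem_univ, if_true]
    ring

theorem norm_inv_letter_mul {g : FreeGroup X} {z : X × Bool} (h : g ∈ startsWith z) :
    norm ((letter z)⁻¹ * g) + 1 = norm g := by
  rw [← norm_letter_mul (inv_letter_mul_notMem h), mul_inv_cancel_left]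

theorem norm_pow_of_forall {v : FreeGroup X} (h : ∀ z, v⁻¹ ∈ startsWith z → v ∉ startsWith z)
    (n : ℕ) : norm (v ^ n) = n * norm v := by
  by_cases hv : v = 1
  · simp [hv]
  obtain ⟨c, hc⟩ := exists_startsWith hv
  have h1 : ∀ n : ℕ, v ^ (n + 1) ∈ startsWith c := by
    intro n
    induction n with
    | zero => simpa
    | succ n ih =>
      rw [pow_succ']
      exact mul_mem_startsWith ih (fun h' => h c h' hc) hc
  induction n with
  | zero => simp
  | succ n ih =>
    cases n with
    | zero => simp
    | succ n =>
      rw [pow_succ', norm_mul_of_forall, ih]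
      · ring
      · intro z hz hz'
        exact h z hz (startsWith_unique (h1 n) hz' ▸ hc)

section Cyclic

variable [Finite X] {v : FreeGroup X} (hv : ∀ z, v⁻¹ ∈ startsWith z → v ∉ startsWith z)
include hv

theorem ncard_crossings_pow (z : X × Bool) (n : ℕ) :
    (crossings z (v ^ n)).ncard = n * (crossings z v).ncard := by
  cases nonempty_fintype X
  have h1 : ∀ z ∈ Finset.univ, (crossings z (v ^ n)).ncard ≤ n * (crossings z v).ncard := by
    intro z _
    induction n with
    | zero => simp [crossings]
    | succ n ih =>
      rw [pow_succ, add_mul, one_mul]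
      exact (ncard_crossings_mul_le _ _ _).trans (Nat.add_le_add_right ih _)
  refine (Finset.sum_eq_sum_iff_of_le h1).1 ?_ z (Finset.mem_univ z)
  rw [← Finset.mul_sum, sum_ncard_crossings, sum_ncard_crossings, norm_pow_of_forall hv]
  ring

theorem crossings_pow_succ (z : X × Bool) (n : ℕ) :
    Disjoint (crossings z (v ^ n)) ((fun h => h * v ^ n) ⁻¹' crossings z v) ∧
      crossings z (v ^ (n + 1)) = crossings z (v ^ n) ∪ (fun h => h * v ^ n) ⁻¹' crossings z v := by
  have h1 := crossings_mul_subset z (v ^ n) v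
  rw [← pow_succ] at h1
  have hf := finite_crossings z (v ^ n)
  have hf' := finite_preimage_crossings z (v ^ n) v
  have h2 := Set.ncard_le_ncard h1 (hf.union hf')
  have h3 := Set.ncard_union_add_ncard_inter _ _ hf hf'
  rw [ncard_preimage_mul_right] at h3
  rw [ncard_crossings_pow hv z (n + 1)] at h2
  rw [ncard_crossings_pow hv z n] at h3
  have h4 : (n + 1) * (crossings z v).ncard = n * (crossings z v).ncard + (crossings z v).ncard := by
    ring
  constructor
  · rw [Set.disjoint_iff_inter_eq_empty, ← Set.ncard_eq_zero (hf.inter_of_left _)]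
    omega
  · refine Set.eq_of_subset_of_ncard_le h1 ?_ (hf.union hf')
    rw [ncard_crossings_pow hv z (n + 1)]
    omega

theorem crossings_subset_pow (z : X × Bool) (n : ℕ) :
    crossings z v ⊆ crossings z (v ^ (n + 1)) := by
  induction n with
  | zero => simp
  | succ n ih =>
    rw [(crossings_pow_succ hv z (n + 1)).2]
    exact ih.trans Set.subset_union_left

theorem mul_pow_notMem_crossings {z : X × Bool} {h : FreeGroup X} (hh : h ∈ crossings z v) (n : ℕ) :
    h * v ^ (n + 1) ∉ crossings z v :=
  Set.disjoint_left.1 (crossings_pow_succ hv z (n + 1)).1 (crossings_subset_pow hv z n hh)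

theorem mul_zpow_notMem_crossings {z : X × Bool} {h : FreeGroup X} (hh : h ∈ crossings z v) {i : ℤ}
    (hi : i ≠ 0) : h * v ^ i ∉ crossings z v := by
  obtain ⟨n, rfl | rfl⟩ := Int.eq_nat_or_neg i
  · obtain ⟨m, rfl⟩ := Nat.exists_eq_succ_of_ne_zero (n := n) (by simpa using hi)
    rw [zpow_natCast]
    exact mul_pow_notMem_crossings hv hh m
  · obtain ⟨m, rfl⟩ := Nat.exists_eq_succ_of_ne_zero (n := n) (by simpa using hi)
    intro h'
    have := mul_pow_notMem_crossings hv h' m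
    rw [zpow_neg, zpow_natCast, inv_mul_cancel_right] at this
    exact this hh

theorem line_mem_linesBetween {z : X × Bool} {h : FreeGroup X} (hh : h ∈ crossings z v) :
    line v h ∈ linesBetween v (branch v z) (branch v z)ᶜ := by
  have h1 : ∀ n : ℕ, (h * v ^ (n + 1) ∈ startsWith z ↔ h ∉ startsWith z) := fun n => by
    have := crossings_subset_pow hv z n hh
    simp only [crossings, Set.mem_ofPred_eq] at this
    tauto
  have h2 : ∀ n : ℕ, (h * (v ^ n)⁻¹ ∈ startsWith z ↔ h ∈ startsWith z) := fun n => by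
    induction n with
    | zero => simp
    | succ n ih =>
      rw [← ih]
      have := mul_zpow_notMem_crossings hv hh (i := -(n + 1 : ℕ)) (by simp; omega)
      simp only [crossings, Set.mem_ofPred_eq, not_not, zpow_neg, zpow_natCast] at this
      rwa [mul_assoc, pow_succ', mul_inv_rev, inv_mul_cancel_right, ← mul_inv_rev, ← pow_succ'] at this
  have h3 : ∀ᶠ i : ℤ in Filter.atTop, (h * v ^ i ∈ startsWith z ↔ h ∉ startsWith z) := by
    filter_upwards [Filter.eventually_ge_atTop 1] with i hi
    obtain ⟨n, rfl⟩ := Int.eq_ofNat_of_zero_le (a := i) (by omega)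
    obtain ⟨m, rfl⟩ := Nat.exists_eq_succ_of_ne_zero (n := n) (by omega)
    rw [zpow_natCast]
    exact h1 m
  have h4 : ∀ᶠ i : ℤ in Filter.atBot, (h * v ^ i ∈ startsWith z ↔ h ∈ startsWith z) := by
    filter_upwards [Filter.eventually_le_atBot 0] with i hi
    obtain ⟨n, rfl⟩ := Int.exists_eq_neg_ofNat hi
    rw [zpow_neg, zpow_natCast]
    exact h2 n
  refine ⟨h, ?_, rfl⟩
  simp only [branch, ends, Set.mem_ofPred_eq, Set.mem_compl_iff, cond_true, cond_false,
    Filter.eventually_congr h3, Filter.eventually_congr h4, Filter.eventually_const]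
  tauto

theorem weight_branch (hv1 : Function.Injective fun i : ℤ => v ^ i) (z : X × Bool) :
    weight v (branch v z) = (crossings z v).ncard := by
  have h1 : linesBetween v (branch v z) (branch v z)ᶜ = line v '' crossings z v := by
    refine Set.Subset.antisymm
      (linesBetween_compl_subset hv1 (almostInvariant_startsWith z)) ?_
    rintro _ ⟨h, hh, rfl⟩
    exact line_mem_linesBetween hv hh
  rw [weight, h1]
  refine Set.InjOn.ncard_image fun h hh h' hh' e => ?_
  obtain ⟨i, rfl⟩ := line_eq_line_iff.1 e
  by_cases hi : i = 0
  · simp [hi]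
  · exact absurd hh' (mul_zpow_notMem_crossings hv hh hi)

end Cyclic

end Length

section CyclicLength

variable {X : Type} [DecidableEq X]

theorem cyclicLength_le (w g : FreeGroup X) : cyclicLength w ≤ norm (g * w * g⁻¹) :=
  Nat.sInf_le ⟨g, rfl⟩

theorem exists_cyclicLength (w : FreeGroup X) : ∃ g, norm (g * w * g⁻¹) = cyclicLength w :=
  Nat.sInf_mem (Set.range_nonempty _)

theorem cyclicLength_conj (w g : FreeGroup X) : cyclicLength (g * w * g⁻¹) = cyclicLength w := by
  apply le_antisymm
  · obtain ⟨k, hk⟩ := exists_cyclicLength w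
    rw [← hk]
    refine (cyclicLength_le _ (k * g⁻¹)).trans (le_of_eq ?_)
    congr 1
    group
  · obtain ⟨k, hk⟩ := exists_cyclicLength (g * w * g⁻¹)
    rw [← hk]
    refine (cyclicLength_le _ (k * g)).trans (le_of_eq ?_)
    congr 1
    group

theorem notMem_startsWith_of_cyclicallyReduced {v : FreeGroup X} (hv : CyclicallyReduced v)
    (z : X × Bool) (h : v⁻¹ ∈ startsWith z) : v ∉ startsWith z := fun h' => by
  have h1 := norm_inv_letter_mul h'
  have h2 : v⁻¹ * letter z ∈ startsWith z := by
    by_contra hc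
    rcases startsWith_mul_letter.1 (show ¬ (v⁻¹ ∈ startsWith z ↔ v⁻¹ * letter z ∈ startsWith z) by
      tauto) with ⟨h3, -⟩ | ⟨-, h3⟩
    · exact one_notMem_startsWith z (h3 ▸ h)
    · exact bar_ne z h3.symm
  have h3 := norm_inv_letter_mul h2
  have h4 := cyclicLength_le v (letter z)⁻¹
  rw [← norm_inv_eq, show ((letter z)⁻¹ * v * (letter z)⁻¹⁻¹)⁻¹ = (letter z)⁻¹ * (v⁻¹ * letter z) by
    group] at h4
  have h5 : norm (v⁻¹ * letter z) = norm ((letter z)⁻¹ * v) := by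
    rw [← norm_inv_eq, mul_inv_rev, inv_inv]
  rw [CyclicallyReduced] at hv
  omega

omit [DecidableEq X] in
theorem zpow_injective {v : FreeGroup X} (hv : v ≠ 1) : Function.Injective fun i : ℤ => v ^ i := by
  intro i j hij
  have h : v ^ (i - j) = 1 := by rw [zpow_sub, mul_inv_eq_one]; exact hij
  rw [IsMulTorsionFree.zpow_eq_one_iff_right hv] at h
  omega

variable [Fintype X]

theorem sum_weight_branch {v : FreeGroup X} (hv : v ≠ 1) :
    ∑ z, weight v (branch v z) = 2 * cyclicLength v := by
  obtain ⟨k, hk⟩ := exists_cyclicLength v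
  have h1 : CyclicallyReduced (k * v * k⁻¹) := by
    rw [CyclicallyReduced, hk, cyclicLength_conj]
  have h2 : k * v * k⁻¹ ≠ 1 := by simpa using hv
  have h3 : ∀ z, weight v (branch v z) = weight (k * v * k⁻¹) (branch (k * v * k⁻¹) z) := by
    intro z
    have h4 : affineImage k⁻¹ (MulAut.conj k) (startsWith z) = {h | h * k ∈ startsWith z} := by
      ext h
      simp [affineImage]
    rw [branch, branch, ← ends_mul_right (zpow_injective h2) (almostInvariant_startsWith z) k, ← h4]
    have := ends_affineImage (w := v) (A := startsWith z) k⁻¹ (MulAut.conj k)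
    rw [MulAut.conj_apply] at this
    rw [this]
    exact (weight_affineEnds (w := v) k⁻¹ (MulAut.conj k) _).symm
  simp only [h3, weight_branch (notMem_startsWith_of_cyclicallyReduced h1) (zpow_injective h2),
    sum_ncard_crossings, hk]

end CyclicLength

end FreeGroup

namespace FreeGroup

section Whitehead

variable {X : Type*} [DecidableEq X]

/-- The factor by which a Whitehead automorphism modifies a letter. -/
def whiteheadFactor (P : Finset (X × Bool)) (y z : X × Bool) : FreeGroup X :=
  if z ∈ P then letter y else 1

/-- The endomorphism sending a letter `z` to `e z * z * (e z⁻¹)⁻¹`, where `e z = y` for `z ∈ P`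
and `e z = 1` otherwise. -/
def whiteheadHom (P : Finset (X × Bool)) (y : X × Bool) : FreeGroup X →* FreeGroup X :=
  lift fun x => whiteheadFactor P y (x, true) * letter (x, true) *
    (whiteheadFactor P y (x, false))⁻¹

variable {P : Finset (X × Bool)} {y : X × Bool}

theorem whiteheadHom_letter (z : X × Bool) : whiteheadHom P y (letter z) =
    whiteheadFactor P y z * letter z * (whiteheadFactor P y (bar z))⁻¹ := by
  have h : ∀ x : X, whiteheadHom P y (letter (x, true)) =
      whiteheadFactor P y (x, true) * letter (x, true) * (whiteheadFactor P y (x, false))⁻¹ :=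
    fun x => lift_apply_of
  obtain ⟨x, b⟩ := z
  cases b
  · rw [show ((x, false) : X × Bool) = bar (x, true) from rfl, letter_bar, _root_.map_inv, h, bar_bar]
    simp [bar, mul_assoc]
  · exact h x

omit [DecidableEq X] in
theorem hom_ext_letter {G : Type*} [Group G] {f g : FreeGroup X →* G}
    (h : ∀ z, f (letter z) = g (letter z)) : f = g :=
  ext_hom f g fun x => h (x, true)

variable (hy : y ∉ P) (hy' : bar y ∉ P)
include hy hy'

theorem whiteheadHom_self : whiteheadHom P y (letter y) = letter y := by
  simp [whiteheadHom_letter, whiteheadFactor, hy, hy']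

theorem whiteheadHom_comp : (whiteheadHom P (bar y)).comp (whiteheadHom P y) = MonoidHom.id _ := by
  have h1 : whiteheadHom P (bar y) (letter y) = letter y := by
    have := whiteheadHom_self (P := P) (y := bar y) hy' (by rwa [bar_bar])
    rwa [letter_bar, _root_.map_inv, inv_inj] at this
  refine hom_ext_letter fun z => ?_
  simp only [MonoidHom.comp_apply, MonoidHom.id_apply, whiteheadHom_letter, _root_.map_mul, _root_.map_inv]
  by_cases h2 : z ∈ P <;> by_cases h3 : bar z ∈ P <;> simp [whiteheadFactor, h2, h3, h1, mul_assoc]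

/-- The Whitehead automorphism attached to a letter `y` and a set of letters `P`. -/
def whiteheadAut : MulAut (FreeGroup X) :=
  MonoidHom.toMulEquiv (whiteheadHom P y) (whiteheadHom P (bar y)) (whiteheadHom_comp hy hy') (by
    have := whiteheadHom_comp (P := P) (y := bar y) hy' (by rwa [bar_bar])
    rwa [bar_bar] at this)

theorem whiteheadAut_letter (z : X × Bool) : whiteheadAut hy hy' (letter z) =
    whiteheadFactor P y z * letter z * (whiteheadFactor P y (bar z))⁻¹ :=
  whiteheadHom_letter z

theorem whiteheadAut_mem (u : FreeGroup X) :
    (whiteheadAut hy hy' u ∈ startsWith y ↔ u ∈ startsWith y ∨ ∃ z ∈ P, u ∈ startsWith z) ∧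
    (∀ x, x ∉ P → x ≠ y → x ≠ bar y → (whiteheadAut hy hy' u ∈ startsWith x ↔ u ∈ startsWith x)) ∧
    (∀ x ∈ P, ((letter y)⁻¹ * whiteheadAut hy hy' u ∈ startsWith x ↔ u ∈ startsWith x)) := by
  have hu : ∀ {g : FreeGroup X} {a b}, g ∈ startsWith a → g ∈ startsWith b → a = b :=
    startsWith_unique
  induction u using reduced_induction with
  | one =>
    simp only [_root_.map_one, one_notMem_startsWith, mul_one, inv_letter_mem_iff, and_false,
      exists_false, or_self, implies_true, true_and, iff_false]
    rintro x hx rfl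
    exact hy' hx
  | mul z v hv ih =>
    obtain ⟨h1, h2, h3⟩ := ih
    have hz : ∀ a, letter z * v ∈ startsWith a ↔ a = z := fun a => letter_mul_mem_iff_eq hv
    rw [_root_.map_mul, whiteheadAut_letter]
    set t := whiteheadAut hy hy' v with ht
    simp only [hz]
    by_cases hzy : z = y
    · subst hzy
      have key : v = 1 ∨ t ∈ startsWith z ∨ ∃ x, x ∉ P ∧ x ≠ z ∧ x ≠ bar z ∧ t ∈ startsWith x := by
        by_cases hv1 : v = 1
        · exact Or.inl hv1
        · obtain ⟨x, hx⟩ := exists_startsWith hv1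
          by_cases hxz : x = z
          · exact Or.inr (Or.inl (h1.2 (Or.inl (hxz ▸ hx))))
          by_cases hxP : x ∈ P
          · exact Or.inr (Or.inl (h1.2 (Or.inr ⟨x, hxP, hx⟩)))
          have hxz' : x ≠ bar z := by rintro rfl; exact hv hx
          exact Or.inr (Or.inr ⟨x, hxP, hxz, hxz', (h2 x hxP hxz hxz').2 hx⟩)
      have ht1 : v = 1 → t = 1 := by rintro rfl; simp [ht]
      have ha : t ∉ startsWith (bar z) := by
        intro h
        rcases key with h' | h' | ⟨x, -, -, hx, h'⟩
        · exact one_notMem_startsWith _ (ht1 h' ▸ h)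
        · exact bar_ne z (hu h h')
        · exact hx (hu h' h)
      simp only [whiteheadFactor, hy, hy', if_false, one_mul, inv_one, mul_one,
        letter_mul_mem_iff_eq ha, inv_mul_cancel_left, true_or, true_and]
      refine ⟨fun _ _ _ _ => trivial, fun x hx => ⟨fun h => ?_, fun h => ?_⟩⟩
      · rcases key with h' | h' | ⟨x', hx', -, -, h'⟩
        · exact absurd (ht1 h' ▸ h) (one_notMem_startsWith _)
        · exact hu h h'
        · exact absurd (hu h h' ▸ hx) hx'
      · exact absurd (h ▸ hx) hy
    by_cases hzy' : z = bar y
    · subst hzy'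
      rw [bar_bar] at hv
      have key : (letter y)⁻¹ * t ∈ startsWith (bar y) ∨
          ∃ x ∈ P, (letter y)⁻¹ * t ∈ startsWith x := by
        by_cases hty : t ∈ startsWith y
        · rcases h1.1 hty with h | ⟨x, hx, h⟩
          · exact absurd h hv
          · exact Or.inr ⟨x, hx, (h3 x hx).2 h⟩
        · exact Or.inl (inv_letter_mul_mem_iff.2 hty)
      have ha : (letter y)⁻¹ * t ∉ startsWith y := by
        intro h
        rcases key with h' | ⟨x, hx, h'⟩
        · exact bar_ne y (hu h' h)
        · exact hy (hu h' h ▸ hx)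
      simp only [whiteheadFactor, hy, hy', if_false, one_mul, inv_one, mul_one, bar_bar, letter_bar]
      refine ⟨iff_of_false ha ?_, fun x hxP hxy hxy' => iff_of_false (fun h => ?_) hxy',
        fun x hx => iff_of_false (fun h => ?_) ?_⟩
      · rintro (h | ⟨x, hx, h⟩)
        · exact bar_ne y h.symm
        · exact hy' (h ▸ hx)
      · rcases key with h' | ⟨x', hx', h'⟩
        · exact hxy' (hu h h')
        · exact hxP (hu h h' ▸ hx')
      · exact hy' (hu h (inv_letter_mul_mem_iff.2 ha) ▸ hx)
      · rintro rfl
        exact hy' hx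
    · have hs : (whiteheadFactor P y (bar z))⁻¹ * t ∉ startsWith (bar z) := by
        by_cases hb : bar z ∈ P
        · simp only [whiteheadFactor, hb, if_true]
          rwa [h3 _ hb]
        · simp only [whiteheadFactor, hb, if_false, inv_one, one_mul]
          rwa [h2 _ hb (fun h => hzy' (bar_eq_iff.1 h)) (fun h => hzy (bar_injective h))]
      rw [mul_assoc, mul_assoc]
      set s := letter z * ((whiteheadFactor P y (bar z))⁻¹ * t) with hsdef
      have hs' : ∀ a, s ∈ startsWith a ↔ a = z := fun a => letter_mul_mem_iff_eq hs
      by_cases hzP : z ∈ P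
      · have hsy : s ∉ startsWith (bar y) := fun h => hzy' ((hs' _).1 h).symm
        simp only [whiteheadFactor, hzP, if_true, inv_mul_cancel_left, hs',
          letter_mul_mem_iff_eq hsy]
        refine ⟨iff_of_true trivial (Or.inr ⟨z, hzP, rfl⟩), fun x hx hxy _ =>
          iff_of_false hxy (by rintro rfl; exact hx hzP), fun x _ => trivial⟩
      · have hsy : s ∉ startsWith y := fun h => hzy ((hs' _).1 h).symm
        simp only [whiteheadFactor, hzP, if_false, one_mul, hs']
        refine ⟨iff_of_false (fun h => hzy h.symm) ?_, fun x _ _ _ => trivial, fun x hx =>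
          iff_of_false (fun h => hy' (hu h (inv_letter_mul_mem_iff.2 hsy) ▸ hx))
            (by rintro rfl; exact hzP hx)⟩
        rintro (h | ⟨x, hx, rfl⟩)
        · exact hzy h.symm
        · exact hzP hx

end Whitehead

section Bridge

variable {X : Type}

theorem mem_Xpm {g : FreeGroup X} : g ∈ Xpm X ↔ ∃ z, g = letter z := by
  constructor
  · rintro (⟨x, rfl⟩ | ⟨x, rfl⟩)
    · exact ⟨(x, true), rfl⟩
    · exact ⟨(x, false), rfl⟩
  · rintro ⟨⟨x, b⟩, rfl⟩
    cases b
    · exact Or.inr ⟨x, rfl⟩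
    · exact Or.inl ⟨x, rfl⟩

variable [DecidableEq X] {P : Finset (X × Bool)} {y : X × Bool}

theorem isTypeII_whiteheadAut (hy : y ∉ P) (hy' : bar y ∉ P) :
    IsTypeII (whiteheadAut hy hy') := by
  refine ⟨letter (bar y), mem_Xpm.2 ⟨_, rfl⟩, ?_, ?_⟩
  · simp [whiteheadAut_letter, whiteheadFactor, hy, hy']
  · intro x hx
    obtain ⟨z, rfl⟩ := mem_Xpm.1 hx
    rw [whiteheadAut_letter]
    by_cases h2 : z ∈ P <;> by_cases h3 : bar z ∈ P <;> simp [whiteheadFactor, h2, h3]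

end Bridge

section HalfSpace

variable {X : Type*} [DecidableEq X] [Finite X] [Nontrivial X] {w : FreeGroup X}

/-- A half-space is a translate of the image of a branch under an automorphism. -/
def IsHalfSpace (w : FreeGroup X) (β : MulAut (FreeGroup X)) (A : Set (FreeGroup X × Bool)) : Prop :=
  ∃ g z, A = affineEnds g β (branch w z)

theorem eq_singleton_of_isHalfSpace (hw : Function.Injective fun i : ℤ => w ^ i)
    {Z : Set (X × Bool)} (h : IsHalfSpace w 1 (branches w Z)) : ∃ c, Z = {c} ∨ Z = {c}ᶜ := by
  obtain ⟨g, z, h⟩ := h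
  obtain ⟨p, z', hp, he⟩ := exists_reduced hw g z
  have h1 : ∃ c, affineEnds p 1 (branch w z') ⊆ branch w c := by
    by_cases hp1 : p = 1
    · exact ⟨z', by rw [hp1, affineEnds_one_one]⟩
    · obtain ⟨c, hc⟩ := exists_startsWith hp1
      exact ⟨c, translate_branch_subset hp hc⟩
  obtain ⟨c, hc⟩ := h1
  have key : ∀ Y, affineEnds p 1 (branch w z') = branches w Y → Y = {c} := by
    intro Y hY
    rw [hY, ← branches_singleton, branches_subset_iff hw, Set.subset_singleton_iff_eq] at hc
    refine hc.resolve_left ?_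
    rintro rfl
    obtain ⟨q, hq⟩ := (affineEnds_nonempty_iff p 1).2 (branch_nonempty hw z')
    rw [hY, mem_branches] at hq
    simp at hq
  refine ⟨c, he.imp (fun he => key Z ?_) (fun he => ?_)⟩
  · rw [← he, h]
  · rw [← key Zᶜ, compl_compl]
    rw [← branches_compl hw, h, he, compl_compl]

end HalfSpace

section Inequality

variable {X : Type} [DecidableEq X] [Fintype X] {w : FreeGroup X}

omit [DecidableEq X] [Fintype X] in
theorem weight_preimage (τ : MulAut (FreeGroup X)) (k : FreeGroup X) (A : Set (FreeGroup X)) :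
    weight w (ends w {u | k * τ u ∈ A}) = weight (τ w) (ends (τ w) A) := by
  have h1 : {u | k * τ u ∈ A} = affineImage (τ⁻¹ k⁻¹) τ⁻¹ A := by
    ext u
    simp [affineImage]
  have h2 := ends_affineImage (w := τ w) (A := A) (τ⁻¹ k⁻¹) τ⁻¹
  have h3 : τ⁻¹ (τ w) = w := by simp
  have h4 := weight_affineEnds (w := τ w) (τ⁻¹ k⁻¹) τ⁻¹ (ends (τ w) A)
  rw [h3] at h2 h4
  rw [h1, h2, h4]

theorem weight_lt_of_mem_TS [Nontrivial X] (hw1 : w ≠ 1) (hw : w ∈ TS X) {Z : Finset (X × Bool)}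
    {y : X × Bool} (hy : y ∈ Z) (hy' : bar y ∉ Z) (h1 : Z ≠ {y}) (h2 : Z ≠ {bar y}ᶜ) :
    weight w (branch w y) < weight w (branches w Z) := by
  have hwi := zpow_injective hw1
  have hP : y ∉ Z.erase y := by simp
  have hP' : bar y ∉ Z.erase y := fun h => hy' (Finset.mem_of_mem_erase h)
  set τ := whiteheadAut hP hP' with hτ
  have hmem := whiteheadAut_mem hP hP'
  rw [← hτ] at hmem
  have hZ : {u | 1 * τ u ∈ startsWith y} = ⋃ z ∈ Z, startsWith z := by
    ext u
    simp only [one_mul, Set.mem_ofPred_eq, (hmem u).1, Set.mem_iUnion, exists_prop,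
      Finset.mem_erase]
    constructor
    · rintro (h | ⟨z, hz, h⟩)
      · exact ⟨y, hy, h⟩
      · exact ⟨z, hz.2, h⟩
    · rintro ⟨z, hz, h⟩
      by_cases hzy : z = y
      · exact Or.inl (hzy ▸ h)
      · exact Or.inr ⟨z, ⟨hzy, hz⟩, h⟩
  have hni : ¬ IsInnerAut τ := by
    rintro ⟨k, hk⟩
    have h3 : branches w Z = affineEnds k⁻¹ 1 (branch w y) := by
      rw [branches_eq_ends hwi, ← hZ, branch, affineEnds_ends]
      have h4 : AlmostInvariant (affineImage k⁻¹ 1 (startsWith y)) :=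
        (almostInvariant_startsWith y).affineImage _ _
      rw [← ends_mul_right hwi h4 k⁻¹]
      congr 1
      ext u
      simp [affineImage, hk, mul_assoc]
    obtain ⟨c, hc | hc⟩ := eq_singleton_of_isHalfSpace hwi ⟨_, _, h3⟩
    · have : y = c := by
        have h5 : y ∈ (Z : Set (X × Bool)) := hy
        rwa [hc] at h5
      exact h1 (by rw [← Finset.coe_inj, hc, this]; simp)
    · have : bar y = c := by
        by_contra h6
        have h5 : bar y ∈ (Z : Set (X × Bool)) := by
          rw [hc]
          exact h6
        exact hy' h5
      exact h2 (by rw [← Finset.coe_inj, hc, this]; simp)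
  have hlt := hw.2.2.1 τ (isTypeII_whiteheadAut hP hP') hni
  by_contra hle
  rw [not_lt] at hle
  have hτw : τ w ≠ 1 := by simpa using hw1
  have h3 : weight (τ w) (branch (τ w) y) = weight w (branches w Z) := by
    rw [branches_eq_ends hwi, ← hZ, weight_preimage]; rfl
  have h4 : ∀ z ∈ Finset.univ, weight (τ w) (branch (τ w) z) ≤ weight w (branch w z) := by
    intro z _
    by_cases hzy : z = y
    · rw [hzy, h3]; exact hle
    by_cases hzy' : z = bar y
    · rw [hzy', weight_branch_bar (zpow_injective hτw), h3, weight_branch_bar hwi]; exact hle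
    by_cases hzP : z ∈ Z.erase y
    · have h5 : {u | (letter y)⁻¹ * τ u ∈ startsWith z} = startsWith z := by
        ext u; exact (hmem u).2.2 z hzP
      rw [branch, ← weight_preimage, h5]; rfl
    · have h5 : {u | 1 * τ u ∈ startsWith z} = startsWith z := by
        ext u
        rw [Set.mem_ofPred_eq, one_mul]
        exact (hmem u).2.1 z hzP hzy hzy'
      rw [branch, ← weight_preimage τ 1, h5]; rfl
  have h5 := Finset.sum_le_sum h4
  rw [sum_weight_branch hτw, sum_weight_branch hw1] at h5
  omega

end Inequality

section Commute

variable {X : Type*}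

theorem exists_zpow_of_commute {g h : FreeGroup X} (hgh : Commute g h) :
    ∃ (c : FreeGroup X) (m n : ℤ), g = c ^ m ∧ h = c ^ n := by
  classical
  let H : Subgroup (FreeGroup X) := Subgroup.closure {g, h}
  have hcomm : ∀ a b : H, a * b = b * a := by
    have : ∀ x ∈ ({g, h} : Set (FreeGroup X)), ∀ y ∈ ({g, h} : Set (FreeGroup X)), x * y = y * x := by
      rintro x (rfl | rfl) y (rfl | rfl)
      · rfl
      · exact hgh
      · exact hgh.symm
      · rfl
    exact (Subgroup.isMulCommutative_closure this).is_comm.comm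
  let e : H ≃* FreeGroup (IsFreeGroup.Generators H) := IsFreeGroup.toFreeGroup H
  have hs : Subsingleton (IsFreeGroup.Generators H) := by
    refine ⟨fun a b => ?_⟩
    have h1 : letter (a, true) * letter (b, true) = letter (b, true) * letter (a, true) := by
      apply e.symm.injective
      rw [_root_.map_mul, _root_.map_mul, hcomm]
    have h2 : ∀ a b : IsFreeGroup.Generators H,
        letter (a, true) * letter (b, true) ∈ startsWith (a, true) := fun a b =>
      letter_mul_mem (by simp [bar])
    have h3 := h2 a b
    rw [h1] at h3
    exact congrArg Prod.fst (startsWith_unique h3 (h2 b a))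
  have hc : ∃ c : FreeGroup (IsFreeGroup.Generators H), ∀ x, x ∈ Subgroup.zpowers c := by
    by_cases hne : Nonempty (IsFreeGroup.Generators H)
    · obtain ⟨a⟩ := hne
      refine ⟨of a, fun x => ?_⟩
      have h1 : Set.range (of : IsFreeGroup.Generators H → _) = {of a} := by
        ext y
        constructor
        · rintro ⟨b, rfl⟩
          rw [Subsingleton.elim b a]; rfl
        · rintro rfl
          exact ⟨a, rfl⟩
      rw [Subgroup.zpowers_eq_closure, ← h1, closure_range_of]
      trivial
    · rw [not_nonempty_iff] at hne
      exact ⟨1, fun x => ⟨0, Subsingleton.elim _ _⟩⟩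
  obtain ⟨c, hc⟩ := hc
  have key : ∀ x (hx : x ∈ H), ∃ m : ℤ, x = (e.symm c : FreeGroup X) ^ m := by
    intro x hx
    obtain ⟨m, hm⟩ := hc (e ⟨x, hx⟩)
    refine ⟨m, ?_⟩
    have : e.symm (c ^ m) = ⟨x, hx⟩ := by
      simp only at hm
      rw [hm, MulEquiv.symm_apply_apply]
    rw [← Subgroup.coe_zpow, ← map_zpow, this]
  obtain ⟨m, hm⟩ := key g (Subgroup.subset_closure (by simp))
  obtain ⟨n, hn⟩ := key h (Subgroup.subset_closure (by simp))
  exact ⟨_, m, n, hm, hn⟩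

theorem eq_one_of_forall_commute [Nontrivial X] {v : FreeGroup X} (h : ∀ g, Commute v g) :
    v = 1 := by
  classical
  by_contra hv
  obtain ⟨c, hc⟩ := exists_startsWith hv
  obtain ⟨x, hx⟩ := exists_ne c.1
  have h1 : letter (x, true) * v ∈ startsWith (x, true) := letter_mul_mem fun h' =>
    hx (congrArg Prod.fst (startsWith_unique h' hc))
  rw [← (h (letter (x, true))).eq] at h1
  have h2 : v * letter (x, true) ∈ startsWith c := (mul_letter_mem_iff (fun h => absurd h hv)
    (fun _ h' => hx (congrArg Prod.fst h'))).2 hc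
  exact hx (congrArg Prod.fst (startsWith_unique h1 h2))

end Commute

section CommutePower

variable {X : Type}

theorem mem_zpowers_of_commute {u g : FreeGroup X} (hu : ¬ IsProperPower u) (hu1 : u ≠ 1)
    (h : Commute g u) : g ∈ Subgroup.zpowers u := by
  obtain ⟨c, m, n, rfl, rfl⟩ := exists_zpow_of_commute h
  have hn : n.natAbs < 2 := by
    by_contra hc
    rw [not_lt] at hc
    rcases Int.natAbs_eq n with h1 | h1
    · exact hu ⟨c, n.natAbs, hc, by rw [← zpow_natCast, ← h1]⟩
    · exact hu ⟨c⁻¹, n.natAbs, hc, by rw [← zpow_natCast, inv_zpow', ← h1]⟩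
  have hn0 : n ≠ 0 := by rintro rfl; simp at hu1
  rcases (by omega : n = 1 ∨ n = -1) with rfl | rfl
  · exact ⟨m, by simp⟩
  · exact ⟨-m, by simp⟩

end CommutePower

end FreeGroup

theorem exists_first_mem {α : Type*} (f : Equiv.Perm α) {B : Set α} {q : α} (hq : q ∉ B) {J : ℕ}
    (hJ : (f ^ J) q ∈ B) : ∃ k, (f ^ (k + 1)) q ∈ B ∧ (f ^ k) q ∉ B := by
  classical
  have hex : ∃ n, (f ^ n) q ∈ B := ⟨J, hJ⟩
  have h0 : Nat.find hex ≠ 0 := fun h => hq (by simpa [h] using Nat.find_spec hex)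
  obtain ⟨k, hk⟩ := Nat.exists_eq_succ_of_ne_zero h0
  exact ⟨k, by simpa [hk] using Nat.find_spec hex, Nat.find_min hex (by omega)⟩

/-- A set crossing a shifted set `B` and meeting it in its shift has crossing translates. -/
theorem exists_cross_translate {α : Type*} (f : Equiv.Perm α) {A B : Set α}
    (hf : ∀ q, f q ∈ A ∩ B ↔ q ∈ B) (hAB : Cross A B)
    (hJ : ∃ J : ℕ, (∀ q, (f ^ J) q ∉ B → q ∈ A) ∨ (∀ q, (f ^ J) q ∉ B → q ∉ A)) :
    ∃ k : ℕ, Cross A {p | (f ^ k)⁻¹ p ∈ A} := by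
  by_contra hn
  obtain ⟨J, hJ⟩ := hJ
  obtain ⟨-, ⟨q₁, hq₁A, hq₁B⟩, ⟨z, hzA, hzB⟩, ⟨q₂, hq₂A, hq₂B⟩⟩ := hAB
  have hB : ∀ q k, q ∈ B → (f ^ k) q ∈ B := by
    intro q k hq
    induction k with
    | zero => exact hq
    | succ k ih => rw [pow_succ', Equiv.Perm.mul_apply]; exact ((hf _).2 ih).2
  have hA : ∀ q k, q ∈ B → (f ^ (k + 1)) q ∈ A := by
    intro q k hq
    rw [pow_succ', Equiv.Perm.mul_apply]
    exact ((hf _).2 (hB q k hq)).1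
  have hPQ : ∀ k : ℕ, (∀ q ∈ A, (f ^ (k + 1)) q ∈ A) ∨ (∀ q ∉ A, (f ^ (k + 1)) q ∈ A) := by
    intro k
    by_contra hc
    push Not at hc
    obtain ⟨⟨a, haA, ha⟩, b, hbA, hb⟩ := hc
    refine hn ⟨k + 1, ⟨(f ^ (k + 1)) (f z), ?_, ?_⟩, ⟨(f ^ (k + 1)) z, hA z k hzB, ?_⟩,
      ⟨_, ha, ?_⟩, ⟨_, hb, ?_⟩⟩
    · exact hA _ _ (by simpa using hB z 1 hzB)
    · simpa using ((hf z).2 hzB).1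
    · simpa using hzA
    · simpa using haA
    · simpa using hbA
  have hz : ∀ n, (f ^ J) ((f ^ (J + 1 + n))⁻¹ z) ∉ B := by
    intro n h
    have h1 := hA _ n h
    rw [← Equiv.Perm.mul_apply, ← pow_add, show n + 1 + J = J + 1 + n by ring] at h1
    simp at h1
    exact hzA h1
  have hfirst : ∀ q, q ∉ B → (f ^ J) q ∈ B → ∃ k, (f ^ (k + 1)) q ∉ A := by
    intro q hq hqJ
    obtain ⟨k, hk, hk'⟩ := exists_first_mem f hq hqJ
    refine ⟨k, fun h => hk' ((hf _).1 ?_)⟩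
    rw [← Equiv.Perm.mul_apply, ← pow_succ']
    exact ⟨h, hk⟩
  have hsplit : ∀ n, (∀ q ∈ A, (f ^ n) q ∈ A) → ∀ m, ∀ q ∈ A, (f ^ (n * m)) q ∈ A := by
    intro n hn m
    induction m with
    | zero => simp
    | succ m ih =>
      intro q hq
      rw [Nat.mul_succ, pow_add, Equiv.Perm.mul_apply]
      exact ih _ (hn q hq)
  rcases hJ with hJ | hJ
  · have hQ : ∀ k, ∀ q ∉ A, (f ^ (k + 1)) q ∈ A := by
      intro k
      refine (hPQ k).resolve_left fun hP => ?_
      have h1 := hsplit _ hP (J + 1)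
      obtain ⟨n, hn⟩ := Nat.exists_eq_add_of_le (Nat.le_mul_of_pos_left (J + 1) k.succ_pos)
      rw [Nat.succ_eq_add_one] at hn
      have h2 := h1 _ (hJ _ (hz n))
      rw [hn] at h2
      simp at h2
      exact hzA h2
    obtain ⟨k, hk⟩ := hfirst q₂ hq₂B (by by_contra h; exact hq₂A (hJ _ h))
    exact hk (hQ k _ hq₂A)
  · have hP : ∀ n, ∀ q ∈ A, (f ^ (J + n + 1)) q ∈ A := by
      intro n
      refine (hPQ (J + n)).resolve_right fun hQ => ?_
      have h2 := hQ _ (hJ _ (hz n))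
      rw [show J + n + 1 = J + 1 + n by ring] at h2
      simp at h2
      exact hzA h2
    have hP1 : ∀ q ∈ A, (f ^ 1) q ∈ A := by
      refine (hPQ 0).resolve_right fun hQ => ?_
      have h2 := hP 0 _ (hQ _ (hJ _ (hz 1)))
      rw [← Equiv.Perm.mul_apply, ← pow_add, show J + 0 + 1 + (0 + 1) = J + 1 + 1 by ring] at h2
      simp at h2
      exact hzA h2
    obtain ⟨k, hk⟩ := hfirst q₁ hq₁B (by by_contra h; exact hJ _ h hq₁A)
    have := hsplit 1 hP1 (k + 1) q₁ hq₁A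
    rw [one_mul] at this
    exact hk this

namespace FreeGroup

section HalfSpace

variable {X : Type*} [DecidableEq X] {w : FreeGroup X} {β : MulAut (FreeGroup X)}
  {A B : Set (FreeGroup X × Bool)}

theorem IsHalfSpace.map (h : IsHalfSpace w β A) (k : FreeGroup X) (γ : MulAut (FreeGroup X)) :
    IsHalfSpace w (γ * β) (affineEnds k γ A) := by
  obtain ⟨g, z, rfl⟩ := h
  exact ⟨_, z, affineEnds_affineEnds _ _ _ _ _⟩

theorem IsHalfSpace.translate (h : IsHalfSpace w β A) (k : FreeGroup X) :
    IsHalfSpace w β (affineEnds k 1 A) := by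
  have := h.map k 1
  rwa [one_mul] at this

theorem isHalfSpace_branch (w : FreeGroup X) (z : X × Bool) : IsHalfSpace w 1 (branch w z) :=
  ⟨1, z, (affineEnds_one_one _).symm⟩

theorem IsHalfSpace.exists_ends (h : IsHalfSpace w β A) (hβ : β w = w) :
    ∃ S, AlmostInvariant S ∧ A = ends w S := by
  obtain ⟨g, z, rfl⟩ := h
  refine ⟨affineImage g β (startsWith z), (almostInvariant_startsWith z).affineImage _ _, ?_⟩
  have := ends_affineImage (w := w) (A := startsWith z) g β
  rw [hβ] at this
  exact this.symm

theorem IsHalfSpace.lineInvariant (h : IsHalfSpace w β A) (hβ : β w = w) : LineInvariant w A := by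
  obtain ⟨S, -, rfl⟩ := h.exists_ends hβ
  exact lineInvariant_ends _ _

variable (hw : Function.Injective fun i : ℤ => w ^ i)
include hw

theorem IsHalfSpace.finite_linesBetween (h : IsHalfSpace w β A) (hβ : β w = w) :
    (linesBetween w A Aᶜ).Finite := by
  obtain ⟨S, hS, rfl⟩ := h.exists_ends hβ
  exact finite_linesBetween_compl hw hS

theorem IsHalfSpace.compl (h : IsHalfSpace w β A) : IsHalfSpace w β Aᶜ := by
  obtain ⟨g, z, rfl⟩ := h
  refine ⟨g * β (letter z), bar z, ?_⟩
  rw [← affineEnds_compl, ← translate_bar hw, affineEnds_affineEnds, mul_one]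

theorem IsHalfSpace.not_cross (hA : IsHalfSpace w β A) (hB : IsHalfSpace w β B) : ¬ Cross A B := by
  obtain ⟨g, z, rfl⟩ := hA
  obtain ⟨g', z', rfl⟩ := hB
  rw [← cross_affineEnds 1 β⁻¹, affineEnds_affineEnds, affineEnds_affineEnds, inv_mul_cancel]
  exact not_cross_translate hw _ _ _ _

/-- A set of ends of an almost invariant set is decided on deep translates of branches. -/
theorem exists_pow_translate [Finite X] {S : Set (FreeGroup X)} (hS : AlmostInvariant S)
    (y : X × Bool) : ∃ J : ℕ, affineEnds (letter y ^ J)⁻¹ 1 (branch w y)ᶜ ⊆ ends w S ∨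
      affineEnds (letter y ^ J)⁻¹ 1 (branch w y)ᶜ ⊆ (ends w S)ᶜ := by
  obtain ⟨M, hM⟩ := exists_deep_branch hw hS
  have h1 : ∀ n : ℕ, letter y ^ n ∉ startsWith (bar y) ∧ norm (letter y ^ n) = n := by
    intro n
    induction n with
    | zero => simp [one_notMem_startsWith]
    | succ n ih =>
      rw [pow_succ', letter_mul_mem_iff_eq ih.1, norm_letter_mul ih.1, ih.2]
      exact ⟨bar_ne y, rfl⟩
  refine ⟨M + 1, ?_⟩
  rw [← translate_bar hw, affineEnds_affineEnds, mul_one]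
  have h2 := hM ((letter y ^ M)⁻¹) (bar y) (by rw [norm_inv_eq, (h1 M).2])
    (by rw [inv_inv]; exact (h1 M).1)
  simpa [pow_succ'] using h2

end HalfSpace

section NoCross

variable {X : Type} [DecidableEq X] [Fintype X] [Nontrivial X] {w : FreeGroup X}
  {β : MulAut (FreeGroup X)} {A : Set (FreeGroup X × Bool)}

/-- Translation of ends as a permutation. -/
def shift (a : FreeGroup X) : Equiv.Perm (FreeGroup X × Bool) :=
  (Equiv.mulLeft a).prodCongr (Equiv.refl Bool)

omit [DecidableEq X] [Fintype X] [Nontrivial X] in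
theorem shift_apply (a : FreeGroup X) (p : FreeGroup X × Bool) : shift a p = (a * p.1, p.2) := rfl

omit [DecidableEq X] [Fintype X] [Nontrivial X] in
theorem shift_pow (a : FreeGroup X) (n : ℕ) : shift a ^ n = shift (a ^ n) := by
  induction n with
  | zero => ext p <;> simp [shift]
  | succ n ih =>
    rw [pow_succ, ih, pow_succ]
    ext p <;> simp [shift, mul_assoc]

omit [DecidableEq X] [Fintype X] [Nontrivial X] in
theorem shift_mem_affineEnds (a : FreeGroup X) (S : Set (FreeGroup X × Bool))
    (p : FreeGroup X × Bool) : shift a p ∈ affineEnds a 1 S ↔ p ∈ S := by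
  simp [shift, mem_affineEnds]

theorem not_cross_of_minimal_of_mem (hw1 : w ≠ 1) (hw : w ∈ TS X) (hβ : β w = w)
    (hA : IsHalfSpace w β A) {y : X × Bool} (hAB : Cross A (branch w y))
    (hmin : (linesBetween w (A ∩ branch w y) (Aᶜ ∩ branch w y)).ncard ≤
      (linesBetween w (Aᶜ ∩ branch w y) (Aᶜ ∩ (branch w y)ᶜ)).ncard)
    (hchild : ∀ z, z ≠ bar y → affineEnds (letter y) 1 (branch w z) ⊆ A ∨
      affineEnds (letter y) 1 (branch w z) ⊆ Aᶜ)
    (hy : affineEnds (letter y) 1 (branch w y) ⊆ A) : False := by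
  classical
  have hwi := zpow_injective hw1
  let Z : Finset (X × Bool) :=
    {z | z ≠ bar y ∧ affineEnds (letter y) 1 (branch w z) ⊆ A}
  have hZ : ∀ z, z ∈ Z ↔ z ≠ bar y ∧ affineEnds (letter y) 1 (branch w z) ⊆ A := by
    simp [Z]
  have hmemB : ∀ p, shift (letter y) p ∈ branch w y ↔ p ∈ branches w {bar y}ᶜ := fun p => by
    rw [← translate_branches hwi, shift_mem_affineEnds]
  have hmemAB : ∀ p, shift (letter y) p ∈ A ∩ branch w y ↔ p ∈ branches w Z := fun p => by
    rw [Set.mem_inter_iff, hmemB, mem_branches, mem_branches]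
    constructor
    · rintro ⟨hpA, z, hz, hpz⟩
      refine ⟨z, (hZ z).2 ⟨hz, (hchild z hz).resolve_right fun h => ?_⟩, hpz⟩
      exact h ((shift_mem_affineEnds _ _ _).2 hpz) hpA
    · rintro ⟨z, hz, hpz⟩
      have hz := (hZ z).1 hz
      exact ⟨hz.2 ((shift_mem_affineEnds _ _ _).2 hpz), z, hz.1, hpz⟩
  have hABeq : A ∩ branch w y = affineEnds (letter y) 1 (branches w Z) := by
    ext p
    obtain ⟨q, rfl⟩ := (shift (letter y)).surjective p
    rw [hmemAB, shift_mem_affineEnds]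
  have hle := weight_inter_le (hA.lineInvariant hβ) (lineInvariant_branch y)
    (hA.finite_linesBetween hwi hβ) (finite_linesBetween_branch hwi y) hmin
  rw [hABeq, weight_translate] at hle
  have hyZ : y ∈ Z := (hZ y).2 ⟨(bar_ne y).symm, hy⟩
  refine absurd hle (not_le_of_gt (weight_lt_of_mem_TS hw1 hw hyZ (fun h => ((hZ _).1 h).1 rfl) ?_ ?_))
  · intro hZy
    obtain ⟨S, hS, hAS⟩ := hA.exists_ends hβ
    obtain ⟨J, hJ⟩ := exists_pow_translate hwi hS y
    obtain ⟨k, hk⟩ := exists_cross_translate (shift (letter y)) (A := A) (B := branch w y)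
      (fun q => by rw [hmemAB, hZy, Finset.coe_singleton, branches_singleton]) hAB ⟨J, by
        rw [← hAS] at hJ
        have h1 : ∀ q, (shift (letter y) ^ J) q ∉ branch w y →
            q ∈ affineEnds (letter y ^ J)⁻¹ 1 (branch w y)ᶜ := fun q hq => by
          rw [shift_pow] at hq
          simpa [shift_apply, mem_affineEnds] using hq
        exact hJ.imp (fun h q hq => h (h1 q hq)) (fun h q hq => h (h1 q hq))⟩
    refine hA.not_cross hwi (hA.translate (letter y ^ k)) ?_
    convert hk using 1
    ext p
    obtain ⟨q, rfl⟩ := (shift (letter y ^ k)).surjective p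
    simp [shift_mem_affineEnds, shift_pow]
  · intro hZy
    obtain ⟨p, hp, hp'⟩ := hAB.2.2.1
    obtain ⟨q, rfl⟩ := (shift (letter y)).surjective p
    refine hp ((hmemAB q).2 ?_).1
    rw [hZy]
    simpa using (hmemB q).1 hp'

theorem subset_or_subset_compl {α : Type*} {A B C : Set α} (hAB : Cross A B) (hC : C ⊆ B)
    (h : ¬ Cross A C) : C ⊆ A ∨ C ⊆ Aᶜ := by
  by_contra hc
  rw [not_or, Set.not_subset, Set.not_subset] at hc
  obtain ⟨⟨a, ha, ha'⟩, b, hb, hb'⟩ := hc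
  exact h ⟨⟨b, not_not.1 hb', hb⟩, hAB.2.1.mono (Set.inter_subset_inter_right _
    (Set.compl_subset_compl.2 hC)), ⟨a, ha', ha⟩, hAB.2.2.2.mono (Set.inter_subset_inter_right _
    (Set.compl_subset_compl.2 hC))⟩

theorem not_cross_of_minimal (hw1 : w ≠ 1) (hw : w ∈ TS X) (hβ : β w = w)
    (hA : IsHalfSpace w β A) {y : X × Bool} (hAB : Cross A (branch w y))
    (hmin : ∀ A', IsHalfSpace w β A' → Cross A' (branch w y) →
      (linesBetween w (A ∩ branch w y) (Aᶜ ∩ branch w y)).ncard ≤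
      (linesBetween w (A'ᶜ ∩ branch w y) (A'ᶜ ∩ (branch w y)ᶜ)).ncard)
    (hchild : ∀ z, z ≠ bar y → ¬ Cross A (affineEnds (letter y) 1 (branch w z))) : False := by
  have hwi := zpow_injective hw1
  have hc : ∀ z, z ≠ bar y → affineEnds (letter y) 1 (branch w z) ⊆ A ∨
      affineEnds (letter y) 1 (branch w z) ⊆ Aᶜ := fun z hz =>
    subset_or_subset_compl hAB (translate_subset hwi hz) (hchild z hz)
  rcases hc y (bar_ne y).symm with h | h
  · exact not_cross_of_minimal_of_mem hw1 hw hβ hA hAB (hmin A hA hAB) hc h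
  · refine not_cross_of_minimal_of_mem hw1 hw hβ (hA.compl hwi) (cross_compl_left.2 hAB) ?_
      (fun z hz => ?_) h
    · have h1 := hmin Aᶜ (hA.compl hwi) (cross_compl_left.2 hAB)
      rw [compl_compl] at h1 ⊢
      rw [linesBetween_comm]
      exact h1
    · rw [compl_compl]
      exact (hc z hz).symm

theorem IsHalfSpace.not_cross_of_stabilizer (hw1 : w ≠ 1) (hw : w ∈ TS X) (hβ : β w = w)
    (hA : IsHalfSpace w β A) {B : Set (FreeGroup X × Bool)} (hB : IsHalfSpace w 1 B) :
    ¬ Cross A B := by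
  classical
  have hwi := zpow_injective hw1
  intro hcross
  let Q : ℕ → Prop := fun n => ∃ (β : MulAut (FreeGroup X)) (A B : Set (FreeGroup X × Bool)),
    β w = w ∧ IsHalfSpace w β A ∧ IsHalfSpace w 1 B ∧ Cross A B ∧
      (linesBetween w (A ∩ B) (Aᶜ ∩ B)).ncard = n
  have hQ : ∃ n, Q n := ⟨_, β, A, B, hβ, hA, hB, hcross, rfl⟩
  obtain ⟨γ, C, D, hγ, hC, hD, hCD, hm⟩ := Nat.find_spec hQ
  have hmin : ∀ (β : MulAut (FreeGroup X)) (A B : Set (FreeGroup X × Bool)), β w = w →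
      IsHalfSpace w β A → IsHalfSpace w 1 B → Cross A B →
      Nat.find hQ ≤ (linesBetween w (A ∩ B) (Aᶜ ∩ B)).ncard := fun β A B h1 h2 h3 h4 =>
    Nat.find_min' hQ ⟨β, A, B, h1, h2, h3, h4, rfl⟩
  have hmin' : ∀ (β : MulAut (FreeGroup X)) (A B : Set (FreeGroup X × Bool)), β w = w →
      IsHalfSpace w β A → IsHalfSpace w 1 B → Cross A B →
      Nat.find hQ ≤ (linesBetween w (Aᶜ ∩ B) (Aᶜ ∩ Bᶜ)).ncard := by
    intro β A B h1 h2 h3 h4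
    have h1' : β⁻¹ w = w := by rw [MulAut.inv_apply, MulEquiv.symm_apply_eq, h1]
    have h5 := hmin β⁻¹ (affineEnds 1 β⁻¹ B) (affineEnds 1 β⁻¹ Aᶜ) h1'
      (by simpa using h3.map 1 β⁻¹) (by simpa using (h2.compl hwi).map 1 β⁻¹)
      ((cross_affineEnds _ _).2 (cross_compl_right.2 h4.symm))
    rw [← affineEnds_inter, ← affineEnds_compl, ← affineEnds_inter] at h5
    have h6 := ncard_linesBetween_affineEnds (w := w) 1 β⁻¹ (B ∩ Aᶜ) (Bᶜ ∩ Aᶜ)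
    rw [h1'] at h6
    rwa [h6, Set.inter_comm B, Set.inter_comm Bᶜ] at h5
  obtain ⟨g, z, rfl⟩ := hD
  obtain ⟨S, hS, hCS⟩ := (hC.translate g⁻¹).exists_ends hγ
  obtain ⟨M, hM⟩ := exists_deep_branch hwi hS
  set C' := affineEnds g⁻¹ 1 C with hC'
  have hC'C : affineEnds g 1 C' = C := by rw [hC', affineEnds_affineEnds]; simp
  have hCD' : Cross C' (branch w z) := by
    rw [← cross_affineEnds g 1, hC'C]
    exact hCD
  let good : Set ℕ := {n | ∃ p x, norm p = n ∧ p⁻¹ ∉ startsWith x ∧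
    affineEnds p 1 (branch w x) ⊆ branch w z ∧ Cross C' (affineEnds p 1 (branch w x))}
  have hne : good.Nonempty := ⟨0, 1, z, by simp, by simpa using one_notMem_startsWith z, by simp,
    by simpa using hCD'⟩
  have hbdd : BddAbove good := by
    refine ⟨M, ?_⟩
    rintro n ⟨p, x, rfl, hp, -, hcr⟩
    by_contra hlt
    rcases hM p x (by omega) hp with h | h
    · rw [← hCS] at h
      exact not_cross_of_subset h hcr.symm
    · rw [← hCS] at h
      exact not_cross_of_disjoint (Set.subset_compl_iff_disjoint_right.1 h) hcr.symm
  obtain ⟨p, y, hpn, hp, hpz, hpc⟩ := Nat.sSup_mem hne hbdd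
  have hE : IsHalfSpace w γ (affineEnds p⁻¹ 1 C') := (hC.translate g⁻¹).translate p⁻¹
  have hpE : affineEnds p 1 (affineEnds p⁻¹ 1 C') = C' := by rw [affineEnds_affineEnds]; simp
  refine not_cross_of_minimal hw1 hw hγ hE (y := y) ?_ ?_ ?_
  · rw [← cross_affineEnds p 1, hpE]
    exact hpc
  · intro A' hA' hcr
    refine le_trans ?_ (hmin' γ A' _ hγ hA' (isHalfSpace_branch w y) hcr)
    rw [← hm]
    have h1 := ncard_linesBetween_affineEnds (w := w) (g * p) 1
      (affineEnds p⁻¹ 1 C' ∩ branch w y) ((affineEnds p⁻¹ 1 C')ᶜ ∩ branch w y)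
    rw [MulAut.one_apply] at h1
    rw [← h1]
    have h2 : affineEnds (g * p) 1 (affineEnds p⁻¹ 1 C') = C := by
      rw [affineEnds_affineEnds, hC', affineEnds_affineEnds]
      simp
    have h3 : affineEnds (g * p) 1 (branch w y) ⊆ affineEnds g 1 (branch w z) := by
      have := affineEnds_mono g 1 hpz
      rwa [affineEnds_affineEnds] at this
    rw [affineEnds_inter, affineEnds_inter, affineEnds_compl, h2]
    refine Set.ncard_le_ncard (linesBetween_mono (Set.inter_subset_inter_right _ h3)
      (Set.inter_subset_inter_right _ h3)) ((hC.finite_linesBetween hwi hγ).subset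
      (linesBetween_mono Set.inter_subset_left Set.inter_subset_left))
  · intro x hx hcr
    rw [← cross_affineEnds p 1, hpE, affineEnds_affineEnds] at hcr
    simp only [MulAut.one_apply, mul_one] at hcr
    have h1 : norm p + 1 ∈ good := by
      refine ⟨p * letter y, x, norm_mul_letter hp, ?_, ?_, hcr⟩
      · rw [mul_inv_rev, ← letter_bar, letter_mul_mem_iff_eq (by rwa [bar_bar])]
        exact hx
      · refine subset_trans ?_ hpz
        have := affineEnds_mono p 1 (translate_subset hwi (y := y) hx)
        rwa [affineEnds_affineEnds] at this
    have h2 := le_csSup hbdd h1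
    omega

end NoCross

end FreeGroup

namespace FreeGroup

section Vertex

variable {X : Type*} [DecidableEq X] [Finite X] {w : FreeGroup X}
  (hw : Function.Injective fun i : ℤ => w ^ i)
include hw

theorem eq_translate_branches {A : Set (FreeGroup X × Bool)} {g : FreeGroup X}
    (h : ∀ z, affineEnds g 1 (branch w z) ⊆ A ∨ affineEnds g 1 (branch w z) ⊆ Aᶜ) :
    A = affineEnds g 1 (branches w {z | affineEnds g 1 (branch w z) ⊆ A}) := by
  ext p
  constructor
  · intro hp
    obtain ⟨z, hz⟩ := exists_branch hw ((1 : MulAut (FreeGroup X))⁻¹ (g⁻¹ * p.1), p.2)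
    exact mem_branches.2 ⟨z, (h z).resolve_right fun hc => hc hz hp, hz⟩
  · intro hp
    obtain ⟨z, hz, hpz⟩ := mem_branches.1 hp
    exact hz hpz

/-- An almost invariant set of ends that is nested with all half-spaces is, up to translation, a
union of branches. -/
theorem exists_translate_branches {S : Set (FreeGroup X)} (hS : AlmostInvariant S)
    (h1 : (ends w S).Nonempty) (h2 : (ends w S)ᶜ.Nonempty)
    (hcr : ∀ D, IsHalfSpace w 1 D → ¬ Cross (ends w S) D) :
    ∃ g Z, ends w S = affineEnds g 1 (branches w Z) := by
  obtain ⟨M, hM⟩ := exists_deep_branch hw hS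
  set A := ends w S
  have hdec : ∀ p z, ¬ (A ⊆ affineEnds p 1 (branch w z) ∨ Aᶜ ⊆ affineEnds p 1 (branch w z)) →
      affineEnds p 1 (branch w z) ⊆ A ∨ affineEnds p 1 (branch w z) ⊆ Aᶜ := by
    intro p z h
    by_contra hc
    simp only [not_or, Set.not_subset] at h hc
    obtain ⟨⟨⟨a, ha, ha'⟩, b, hb, hb'⟩, ⟨c, hc, hc'⟩, d, hd, hd'⟩ := And.intro h hc
    exact hcr _ ⟨p, z, rfl⟩ ⟨⟨d, not_not.1 hd', hd⟩, ⟨a, ha, ha'⟩, ⟨c, hc', hc⟩, ⟨b, hb, hb'⟩⟩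
  let good : Set ℕ := {n | ∃ p z, norm p = n ∧ p⁻¹ ∉ startsWith z ∧
    (A ⊆ affineEnds p 1 (branch w z) ∨ Aᶜ ⊆ affineEnds p 1 (branch w z))}
  by_cases hbig : ∃ n ∈ good, M ≤ n
  · obtain ⟨_, ⟨p, z, rfl, hp, hA⟩, hn⟩ := hbig
    rcases hA with hA | hA
    · refine ⟨p, {z}, ?_⟩
      rw [branches_singleton]
      refine hA.antisymm ((hM p z hn hp).resolve_right fun h => ?_)
      obtain ⟨q, hq⟩ := h1
      exact h (hA hq) hq
    · refine ⟨p, {z}ᶜ, ?_⟩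
      rw [← branches_compl hw, branches_singleton, affineEnds_compl, eq_compl_comm, eq_comm]
      refine hA.antisymm ((hM p z hn hp).resolve_left fun h => ?_)
      obtain ⟨q, hq⟩ := h2
      exact hq (h (hA hq))
  by_cases hne : good.Nonempty
  · have hbdd : BddAbove good := ⟨M, fun n hn => by
      by_contra hlt
      exact hbig ⟨n, hn, by omega⟩⟩
    obtain ⟨p, y, hpn, hp, hA⟩ := Nat.sSup_mem hne hbdd
    refine ⟨p * letter y, _, eq_translate_branches hw fun z => ?_⟩
    by_cases hz : z = bar y
    · have h3 : affineEnds (p * letter y) 1 (branch w z) = (affineEnds p 1 (branch w y))ᶜ := by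
        rw [hz, ← affineEnds_compl, ← translate_bar hw, affineEnds_affineEnds]
        simp
      rw [h3, Set.compl_subset_compl, Set.compl_subset_comm]
      exact hA.symm
    · refine hdec _ _ fun h => ?_
      have h3 : norm p + 1 ∈ good := by
        refine ⟨p * letter y, z, norm_mul_letter hp, ?_, h⟩
        rw [mul_inv_rev, ← letter_bar, letter_mul_mem_iff_eq (by rwa [bar_bar])]
        exact hz
      have h4 := le_csSup hbdd h3
      omega
  · refine ⟨1, _, eq_translate_branches hw fun z => hdec _ _ fun h => hne ?_⟩
    exact ⟨_, 1, z, rfl, by simpa using one_notMem_startsWith z, h⟩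

end Vertex

end FreeGroup

section Flux

variable {G : Type*} [Group G]

/-- The net number of elements entering `A` under right multiplication by `u`. -/
noncomputable def flux (A : Set G) (u : G) : ℤ :=
  ∑ᶠ h, (A.indicator 1 (h * u) - A.indicator 1 h)

variable {A B : Set G}

theorem AlmostInvariant.finite_support (hA : AlmostInvariant A) (u : G) :
    (Function.support fun h : G => (A.indicator 1 (h * u) - A.indicator 1 h : ℤ)).Finite := by
  refine (hA u).subset fun h hh => ?_
  simp only [Set.mem_ofPred_eq]
  intro hc
  by_cases h1 : h ∈ A
  · simp [h1, hc.1 h1] at hh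
  · simp [h1, mt hc.2 h1] at hh

theorem flux_mul (hA : AlmostInvariant A) (u v : G) : flux A (u * v) = flux A u + flux A v := by
  have h1 : flux A v = ∑ᶠ h, (A.indicator 1 (h * u * v) - A.indicator 1 (h * u) : ℤ) :=
    (finsum_comp_equiv (Equiv.mulRight u)).symm
  rw [h1, flux, flux, ← finsum_add_distrib (hA.finite_support u)]
  · exact finsum_congr fun h => by rw [mul_assoc]; ring
  · exact (hA.finite_support v).preimage (mul_left_injective u).injOn

theorem flux_affineImage (k : G) (β : MulAut G) (u : G) :
    flux (affineImage k β A) (β u) = flux A u := by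
  have h1 := finsum_comp_equiv ((Equiv.mulLeft k⁻¹).trans (β⁻¹ : MulAut G).toEquiv)
    (f := fun h => (A.indicator 1 (h * u) - A.indicator 1 h : ℤ))
  rw [flux, flux, ← h1]
  refine finsum_congr fun h => ?_
  have h2 : ∀ h, (affineImage k β A).indicator (1 : G → ℤ) h = A.indicator 1 (β⁻¹ (k⁻¹ * h)) :=
    fun _ => rfl
  rw [h2, h2, ← mul_assoc, map_mul]
  simp

theorem flux_congr (hA : AlmostInvariant A) (hB : AlmostInvariant B)
    (h : {x | ¬ (x ∈ A ↔ x ∈ B)}.Finite) (u : G) : flux A u = flux B u := by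
  let e : G → ℤ := fun x => A.indicator 1 x - B.indicator 1 x
  have he : (Function.support e).Finite := h.subset fun x hx hc => hx (by
    by_cases h1 : x ∈ A
    · simp [e, h1, hc.1 h1]
    · simp [e, h1, mt hc.2 h1])
  have h1 : ∑ᶠ x, e (x * u) = ∑ᶠ x, e x := finsum_comp_equiv (Equiv.mulRight u)
  rw [← sub_eq_zero, flux, flux, ← finsum_sub_distrib (hA.finite_support u) (hB.finite_support u),
    ← sub_eq_zero.2 h1, ← finsum_sub_distrib (he.preimage (mul_left_injective u).injOn) he]
  exact finsum_congr fun x => by simp only [e]; ring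

theorem flux_biUnion {ι : Type*} (s : Finset ι) {A : ι → Set G} (hA : ∀ i, AlmostInvariant (A i))
    (hd : ∀ i j, i ≠ j → Disjoint (A i) (A j)) (u : G) :
    flux (⋃ i ∈ s, A i) u = ∑ i ∈ s, flux (A i) u := by
  classical
  simp only [flux]
  rw [← finsum_sum_comm _ _ fun i _ => (hA i).finite_support u]
  refine finsum_congr fun h => ?_
  rw [Finset.sum_sub_distrib]
  rw [Finset.indicator_biUnion _ _ fun i _ j _ hij => hd i j hij]

end Flux

namespace FreeGroup

section Flux

variable {X : Type*} [DecidableEq X]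

theorem flux_startsWith (z y : X × Bool) :
    flux (startsWith z) (letter y) = (if z = y then 1 else 0) - (if z = bar y then 1 else 0) := by
  rw [flux]
  have h1 : ∀ h : FreeGroup X, ((startsWith z).indicator 1 (h * letter y) -
      (startsWith z).indicator 1 h : ℤ) = (if h = 1 then (if z = y then 1 else 0) else 0) -
        (if h = letter z then (if z = bar y then 1 else 0) else 0) := by
    intro h
    have h2 := startsWith_mul_letter (h := h) (y := y) (z := z)
    by_cases h3 : h = 1
    · subst h3
      have h4 : letter y ∈ startsWith z ↔ z = y := letter_mem_iff
      by_cases h5 : z = y <;>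
        simp [h4, h5, one_notMem_startsWith, (letter_ne_one _).symm]
    · by_cases h4 : h = letter z
      · subst h4
        by_cases h5 : z = bar y <;>
          simp_all [letter_ne_one]
      · have h5 : h ∈ startsWith z ↔ h * letter y ∈ startsWith z := by tauto
        have h6 : (startsWith z).indicator (1 : FreeGroup X → ℤ) (h * letter y) =
            (startsWith z).indicator 1 h := by
          by_cases h7 : h ∈ startsWith z
          · simp [h7, h5.1 h7]
          · simp [h7, mt h5.2 h7]
        simp [h6, h3, h4]
  simp only [h1]
  rw [finsum_sub_distrib]
  · rw [finsum_eq_single _ 1 (fun h hh => by simp [hh]),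
      finsum_eq_single _ (letter z) (fun h hh => by simp [hh])]
    simp
  · exact (Set.finite_singleton (1 : FreeGroup X)).subset fun h hh => by
      by_contra hc
      simp_all
  · exact (Set.finite_singleton (letter z)).subset fun h hh => by
      by_contra hc
      simp_all

theorem flux_startsWith_bar (z : X × Bool) (u : FreeGroup X) :
    flux (startsWith (bar z)) u = - flux (startsWith z) u := by
  have h1 : ∀ z : X × Bool, ∀ a b : FreeGroup X, flux (startsWith z) (a * b) =
      flux (startsWith z) a + flux (startsWith z) b :=
    fun z => flux_mul (almostInvariant_startsWith z)
  induction u using reduced_induction with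
  | one =>
    have h2 : ∀ z : X × Bool, flux (startsWith z) 1 = 0 := fun z => by simpa using h1 z 1 1
    rw [h2, h2, neg_zero]
  | mul y g _ ih =>
    rw [h1, h1, ih, flux_startsWith, flux_startsWith]
    simp only [bar_eq_iff, bar_bar]
    ring

variable [Finite X] [Nontrivial X] {w : FreeGroup X} (hw : Function.Injective fun i : ℤ => w ^ i)
include hw

theorem flux_eq_of_ends_eq {S T : Set (FreeGroup X)} (hS : AlmostInvariant S)
    (hT : AlmostInvariant T) {β : MulAut (FreeGroup X)} (hβ : β w = w) {k : FreeGroup X}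
    (h : ends w S = affineEnds k β (ends w T)) (u : FreeGroup X) :
    flux S (β u) = flux T u := by
  rw [← ends_affineImage, hβ] at h
  rw [← flux_affineImage k β u]
  exact flux_congr hS (hT.affineImage k β)
    (finite_of_ends_eq hw hS (hT.affineImage k β) h) (β u)

theorem IsHalfSpace.nonempty {A : Set (FreeGroup X × Bool)} {β : MulAut (FreeGroup X)}
    (h : IsHalfSpace w β A) : A.Nonempty := by
  obtain ⟨g, z, rfl⟩ := h
  exact (affineEnds_nonempty_iff _ _).2 (branch_nonempty hw z)

end Flux

section Stabilizer

variable {X : Type} [DecidableEq X] [Fintype X] [Nontrivial X] {w : FreeGroup X}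
  {β : MulAut (FreeGroup X)} {A : Set (FreeGroup X × Bool)}

omit [DecidableEq X] [Fintype X] [Nontrivial X] in
theorem inv_apply_eq_self (hβ : β w = w) : β⁻¹ w = w := by
  rw [MulAut.inv_apply, MulEquiv.symm_apply_eq, hβ]

/-- Automorphisms fixing `w` map half-spaces to half-spaces. -/
theorem IsHalfSpace.of_stabilizer (hw1 : w ≠ 1) (hw : w ∈ TS X) (hβ : β w = w)
    (hA : IsHalfSpace w β A) : IsHalfSpace w 1 A := by
  classical
  have hwi := zpow_injective hw1
  by_contra hA1
  let Q : ℕ → Prop := fun n => ∃ (β : MulAut (FreeGroup X)) (A : Set (FreeGroup X × Bool)),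
    β w = w ∧ IsHalfSpace w β A ∧ ¬ IsHalfSpace w 1 A ∧ weight w A = n
  have hQ : ∃ n, Q n := ⟨_, β, A, hβ, hA, hA1, rfl⟩
  clear hβ hA hA1
  obtain ⟨β, A, hβ, hA, hA1, hm⟩ := Nat.find_spec hQ
  have hmin : ∀ (γ : MulAut (FreeGroup X)) (B : Set (FreeGroup X × Bool)), γ w = w →
      IsHalfSpace w γ B → weight w B < weight w A → IsHalfSpace w 1 B := by
    intro γ B h1 h2 h3
    by_contra h4
    rw [hm] at h3
    exact Nat.find_min hQ h3 ⟨γ, B, h1, h2, h4, rfl⟩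
  obtain ⟨S, hS, hAS⟩ := hA.exists_ends hβ
  obtain ⟨g, Z', hZ'⟩ : ∃ g Z, A = affineEnds g 1 (branches w Z) := by
    rw [hAS]
    refine exists_translate_branches hwi hS (hAS ▸ hA.nonempty hwi)
      (hAS ▸ (hA.compl hwi).nonempty hwi) fun D hD => ?_
    rw [← hAS]
    exact hA.not_cross_of_stabilizer hw1 hw hβ hD
  obtain ⟨Z, rfl⟩ : ∃ Z : Finset (X × Bool), Z' = Z := ⟨Z'.toFinset, by simp⟩
  have hweight : weight w A = weight w (branches w Z) := by rw [hZ', weight_translate]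
  have hbranch : ∀ y ∈ Z, bar y ∉ Z → IsHalfSpace w β (branch w y) := by
    intro y hy hy'
    have hlt := weight_lt_of_mem_TS hw1 hw hy hy' ?_ ?_
    · have h1 : IsHalfSpace w β⁻¹ (affineEnds 1 β⁻¹ (branch w y)) := by
        simpa using (isHalfSpace_branch w y).map 1 β⁻¹
      have h2 := weight_affineEnds (w := w) 1 β⁻¹ (branch w y)
      rw [inv_apply_eq_self hβ] at h2
      have h3 := (hmin β⁻¹ _ (inv_apply_eq_self hβ) h1 (by rw [h2, hweight]; exact hlt)).map 1 β
      rw [affineEnds_affineEnds] at h3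
      simpa using h3
    · rintro rfl
      rw [Finset.coe_singleton, branches_singleton] at hZ'
      exact hA1 ⟨g, y, hZ'⟩
    · rintro rfl
      rw [Finset.coe_compl, Finset.coe_singleton, ← branches_compl hwi, branches_singleton] at hZ'
      exact hA1 (hZ' ▸ ((isHalfSpace_branch w (bar y)).compl hwi).translate g)
  obtain ⟨k, x, hAx⟩ := hA
  have hflux : ∑ y ∈ Z, flux (startsWith y) (β (letter x)) = 1 := by
    have hd : ∀ i j : X × Bool, i ≠ j → Disjoint (startsWith i) (startsWith j) :=
      fun i j hij => Set.disjoint_left.2 fun h hi hj => hij (startsWith_unique hi hj)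
    rw [← flux_biUnion Z almostInvariant_startsWith hd, flux_eq_of_ends_eq hwi
      (AlmostInvariant.biUnion Z almostInvariant_startsWith) (almostInvariant_startsWith x) hβ
      (k := g⁻¹ * k), flux_startsWith]
    · simp [(bar_ne x).symm]
    · rw [← branches_eq_ends hwi]
      have h1 : affineEnds g⁻¹ 1 A = affineEnds g⁻¹ 1 (affineEnds g 1 (branches w Z)) := by
        rw [← hZ']
      rw [affineEnds_affineEnds] at h1
      simp only [MulAut.one_apply, mul_one, inv_mul_cancel, affineEnds_one_one] at h1
      rw [← h1, hAx, affineEnds_affineEnds]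
      simp [branch]
  obtain ⟨y, hy, hy', hne⟩ : ∃ y ∈ Z, bar y ∉ Z ∧ flux (startsWith y) (β (letter x)) ≠ 0 := by
    by_contra hc
    push Not at hc
    have h0 : ∑ y ∈ Z, flux (startsWith y) (β (letter x)) = 0 := by
      refine Finset.sum_involution (fun y _ => if bar y ∈ Z then bar y else y) ?_ ?_ ?_ ?_
      · intro y hy
        by_cases h : bar y ∈ Z
        · simp [h, flux_startsWith_bar]
        · simp [h, hc y hy h]
      · intro y hy h0
        by_cases h : bar y ∈ Z
        · simp [h, bar_ne]
        · exact absurd (hc y hy h) h0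
      · intro y hy
        by_cases h : bar y ∈ Z <;> simp [h, hy]
      · intro y hy
        by_cases h : bar y ∈ Z <;> simp [h, hy]
    rw [h0] at hflux
    exact zero_ne_one hflux
  obtain ⟨k', x', hyx⟩ := hbranch y hy hy'
  rw [flux_eq_of_ends_eq hwi (almostInvariant_startsWith y) (almostInvariant_startsWith x') hβ hyx,
    flux_startsWith] at hne
  have hA2 : IsHalfSpace w 1 (affineEnds k β (branch w x')) := by
    have h1 : affineEnds k β (branch w x') = affineEnds (k * k'⁻¹) 1 (branch w y) := by
      rw [hyx, affineEnds_affineEnds]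
      simp
    rw [h1]
    exact (isHalfSpace_branch w y).translate _
  by_cases hx : x' = x
  · rw [hx] at hA2
    exact hA1 (hAx ▸ hA2)
  · by_cases hx' : x' = bar x
    · rw [hx'] at hA2
      have h1 : A = affineEnds (k * β (letter x) * k⁻¹) 1 (affineEnds k β (branch w (bar x)))ᶜ := by
        rw [← affineEnds_compl, affineEnds_affineEnds, hAx, ← translate_compl_bar hwi,
          affineEnds_affineEnds]
        simp
      exact hA1 (h1 ▸ (hA2.compl hwi).translate _)
    · simp [hx, hx'] at hne

end Stabilizer

end FreeGroup

namespace FreeGroup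

section Rigid

variable {X : Type*} [DecidableEq X] [Finite X] [Nontrivial X] {w : FreeGroup X}
  (hw : Function.Injective fun i : ℤ => w ^ i)
include hw

theorem not_compl_branch_subset (a c : X × Bool) : ¬ (branch w a)ᶜ ⊆ branch w c := by
  rw [← branches_singleton, ← branches_singleton c, branches_compl hw, branches_subset_iff hw]
  intro h
  obtain ⟨x, hx⟩ := exists_ne a.1
  have h1 : bar a = c := h (bar_ne a)
  have h2 : (x, true) = c := h fun h => hx (congrArg Prod.fst h)
  exact hx (congrArg Prod.fst (h2.trans h1.symm))

theorem branch_subset_iff {a b : X × Bool} : branch w a ⊆ branch w b ↔ a = b := by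
  rw [← branches_singleton, ← branches_singleton b, branches_subset_iff hw]
  simp

theorem inv_notMem_of_translate_eq {k : FreeGroup X} {a b : X × Bool}
    (h : affineEnds k 1 (branch w a) = branch w b) : k⁻¹ ∉ startsWith a := by
  intro hk
  have h1 : affineEnds (k * letter a) 1 (branch w (bar a)) = (branch w b)ᶜ := by
    rw [← h, ← affineEnds_compl, ← translate_bar hw, affineEnds_affineEnds]
    simp
  have h2 : (k * letter a)⁻¹ ∉ startsWith (bar a) := by
    rw [mul_inv_rev]
    exact inv_letter_mul_notMem hk
  by_cases hk1 : k * letter a = 1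
  · rw [hk1, affineEnds_one_one] at h1
    exact not_compl_branch_subset hw b (bar a) h1.symm.subset
  · obtain ⟨c, hc⟩ := exists_startsWith hk1
    have h3 := translate_branch_subset (w := w) h2 hc
    rw [h1] at h3
    exact not_compl_branch_subset hw b c h3

theorem eq_one_and_eq_of_translate_eq {k : FreeGroup X} {a b : X × Bool}
    (h : affineEnds k 1 (branch w a) = branch w b) : k = 1 ∧ a = b := by
  have hk : k = 1 := by
    by_contra hk
    obtain ⟨c, hc⟩ := exists_startsWith hk
    have h1 := translate_branch_subset (w := w) (inv_notMem_of_translate_eq hw h) hc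
    rw [h, branch_subset_iff hw] at h1
    have h2 : affineEnds k⁻¹ 1 (branch w b) = branch w a := by
      rw [← h, affineEnds_affineEnds]
      simp
    exact inv_notMem_of_translate_eq hw h2 (by rwa [inv_inv, h1])
  refine ⟨hk, (branch_subset_iff hw).1 ?_⟩
  rw [← h, hk, affineEnds_one_one]

omit [Finite X] [Nontrivial X] in
theorem IsHalfSpace.subset_branch_or {K : Set (FreeGroup X × Bool)} (h : IsHalfSpace w 1 K) :
    ∃ d, K ⊆ branch w d ∨ (branch w d)ᶜ ⊆ K := by
  obtain ⟨g, z, rfl⟩ := h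
  obtain ⟨p, z', hp, h⟩ := exists_reduced hw g z
  obtain ⟨d, hd⟩ : ∃ d, affineEnds p 1 (branch w z') ⊆ branch w d := by
    by_cases hp1 : p = 1
    · exact ⟨z', by rw [hp1, affineEnds_one_one]⟩
    · obtain ⟨d, hd⟩ := exists_startsWith hp1
      exact ⟨d, translate_branch_subset hp hd⟩
  rcases h with h | h
  · exact ⟨d, Or.inl (h.subset.trans hd)⟩
  · exact ⟨d, Or.inr ((Set.compl_subset_compl.2 hd).trans h.symm.subset)⟩

theorem exists_subset_branch {g : FreeGroup X} {β : MulAut (FreeGroup X)} {a c : X × Bool}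
    (h : affineEnds g β (branch w a) = branch w c)
    (hβ : ∀ A, IsHalfSpace w β A → IsHalfSpace w 1 A) (z : X × Bool) :
    ∃ d, affineEnds g β (branch w z) ⊆ branch w d := by
  obtain ⟨d, hd | hd⟩ := (hβ _ ⟨g, z, rfl⟩).subset_branch_or hw
  · exact ⟨d, hd⟩
  · by_cases hz : z = a
    · exact ⟨c, by rw [hz, h]⟩
    · exfalso
      have h1 : Disjoint (affineEnds g β (branch w z)) (branch w c) := by
        rw [← h]
        exact Set.disjoint_left.2 fun p hp hp' => Set.disjoint_left.1 (disjoint_branch hz) hp hp'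
      have h2 : branch w c ⊆ branch w d := fun p hp => by
        by_contra hpd
        exact Set.disjoint_left.1 h1 (hd hpd) hp
      rw [branch_subset_iff hw] at h2
      rw [← h2, ← h, ← affineEnds_compl, affineEnds_subset_iff] at hd
      exact not_compl_branch_subset hw a z hd

theorem exists_eq_branch {g : FreeGroup X} {β : MulAut (FreeGroup X)} {a c : X × Bool}
    (h : affineEnds g β (branch w a) = branch w c)
    (hβ : ∀ A, IsHalfSpace w β A → IsHalfSpace w 1 A)
    (hβ' : ∀ A, IsHalfSpace w β⁻¹ A → IsHalfSpace w 1 A) (z : X × Bool) :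
    ∃ d, affineEnds g β (branch w z) = branch w d := by
  obtain ⟨d, hd⟩ := exists_subset_branch hw h hβ z
  have h1 : affineEnds (β⁻¹ g⁻¹) β⁻¹ (branch w c) = branch w a := by
    rw [← h, affineEnds_inverse]
  obtain ⟨e, he⟩ := exists_subset_branch hw h1 hβ' d
  have h2 := affineEnds_mono (β⁻¹ g⁻¹) β⁻¹ hd
  rw [affineEnds_inverse] at h2
  obtain rfl := (branch_subset_iff hw).1 (h2.trans he)
  refine ⟨d, hd.antisymm ?_⟩
  have h3 := affineEnds_mono g β he
  rw [affineEnds_affineEnds] at h3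
  simpa using h3

theorem conj_apply_letter {g : FreeGroup X} {β : MulAut (FreeGroup X)} {π : X × Bool → X × Bool}
    (h : ∀ z, affineEnds g β (branch w z) = branch w (π z)) (z : X × Bool) :
    g * β (letter z) * g⁻¹ = letter (π z) := by
  have h1 : affineEnds (g * β (letter z) * g⁻¹ * letter (π (bar z))) 1
      (branch w (bar (π (bar z)))) = branch w (π z) := by
    have h2 := translate_bar hw (π (bar z))
    have h3 : affineEnds (g * β (letter z) * g⁻¹) 1 (affineEnds g β (branch w (bar z)))ᶜ =
        branch w (π z) := by
      rw [← h z, ← translate_compl_bar hw z, ← affineEnds_compl, affineEnds_affineEnds,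
        affineEnds_affineEnds]
      simp
    rw [← h3, h, ← h2, affineEnds_affineEnds]
    simp
  obtain ⟨h2, h3⟩ := eq_one_and_eq_of_translate_eq hw h1
  rw [← h3, letter_bar]
  exact eq_inv_of_mul_eq_one_left h2

end Rigid

section Conclusion

variable {X : Type} [DecidableEq X] [Fintype X] [Nontrivial X] {w : FreeGroup X}

omit [Nontrivial X] in
theorem isTypeI_of_letter {σ : MulAut (FreeGroup X)} {π : X × Bool → X × Bool}
    (h : ∀ z, σ (letter z) = letter (π z)) : IsTypeI σ := by
  refine ⟨σ, ⟨?_, σ.injective.injOn, ?_⟩, fun x _ => _root_.map_inv σ x, fun _ => rfl⟩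
  · intro x hx
    obtain ⟨z, rfl⟩ := mem_Xpm.1 hx
    exact mem_Xpm.2 ⟨π z, h z⟩
  · have hπ : Function.Injective π := fun a b hab =>
      letter_injective (σ.injective (by rw [h, h, hab]))
    intro x hx
    obtain ⟨z, rfl⟩ := mem_Xpm.1 hx
    obtain ⟨y, rfl⟩ := Finite.surjective_of_injective hπ z
    exact ⟨letter y, mem_Xpm.2 ⟨y, rfl⟩, h y⟩

theorem exists_eq_conj_of_stabilizer (hw1 : w ≠ 1) (hw : w ∈ TS X) {β : MulAut (FreeGroup X)}
    (hβ : β w = w) : ∃ g, β = MulAut.conj g := by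
  have hwi := zpow_injective hw1
  have h1 : ∀ A, IsHalfSpace w β A → IsHalfSpace w 1 A := fun A hA => hA.of_stabilizer hw1 hw hβ
  have h2 : ∀ A, IsHalfSpace w β⁻¹ A → IsHalfSpace w 1 A := fun A hA =>
    hA.of_stabilizer hw1 hw (inv_apply_eq_self hβ)
  obtain ⟨x⟩ : Nonempty X := inferInstance
  obtain ⟨k, c, hk⟩ := h1 _ ⟨1, (x, true), rfl⟩
  have h3 : affineEnds k⁻¹ β (branch w (x, true)) = branch w c := by
    have h4 := congrArg (affineEnds k⁻¹ 1) hk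
    rw [affineEnds_affineEnds, affineEnds_affineEnds] at h4
    simpa using h4
  choose π hπ using exists_eq_branch hwi h3 h1 h2
  have h4 := conj_apply_letter hwi hπ
  have h5 : IsTypeI (MulAut.conj k⁻¹ * β) := isTypeI_of_letter (π := π) fun z => by
    rw [← h4]
    rfl
  have h6 : MulAut.conj k⁻¹ * β = 1 := by
    by_contra hne
    refine hw.2.2.2 _ h5 hne (isConj_iff.2 ⟨k⁻¹, ?_⟩)
    rw [MulAut.mul_apply, hβ, MulAut.conj_apply]
  refine ⟨k, ?_⟩
  rw [_root_.map_inv, inv_mul_eq_one] at h6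
  exact h6.symm

theorem stabilizer_eq_zpowers (hw1 : w ≠ 1) (hw : w ∈ TS X) :
    MulAction.stabilizer (MulAut (FreeGroup X)) w = Subgroup.zpowers (MulAut.conj w⁻¹) := by
  ext β
  rw [MulAction.mem_stabilizer_iff, MulAut.smul_def]
  constructor
  · intro hβ
    obtain ⟨g, rfl⟩ := exists_eq_conj_of_stabilizer hw1 hw hβ
    rw [MulAut.conj_apply] at hβ
    obtain ⟨n, rfl⟩ := mem_zpowers_of_commute hw.2.1 hw1 (mul_inv_eq_iff_eq_mul.1 hβ)
    exact ⟨-n, by simp⟩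
  · rintro ⟨n, rfl⟩
    have h : (w⁻¹ ^ n) * w = w * w⁻¹ ^ n := ((Commute.refl w).inv_left.zpow_left n).eq
    change (MulAut.conj w⁻¹ ^ n) w = w
    rw [← map_zpow, MulAut.conj_apply, h, mul_inv_cancel_right]

omit [DecidableEq X] [Fintype X] [Nontrivial X] in
theorem stabilizer_conj (g u : FreeGroup X) :
    MulAction.stabilizer (MulAut (FreeGroup X)) (g * u * g⁻¹) =
      (MulAction.stabilizer (MulAut (FreeGroup X)) u).map (MulAut.conj (MulAut.conj g)).toMonoidHom := by
  have := MulAction.stabilizer_smul_eq_stabilizer_map_conj (MulAut.conj g : MulAut (FreeGroup X)) u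
  rwa [MulAut.smul_def, MulAut.conj_apply] at this

omit [DecidableEq X] [Fintype X] in
theorem conj_zpowers_mulEquiv {v : FreeGroup X} (hv : v ≠ 1) :
    Nonempty (Subgroup.zpowers (MulAut.conj v) ≃* Multiplicative ℤ) := by
  have h : ¬ IsOfFinOrder (MulAut.conj v) := by
    rw [isOfFinOrder_iff_pow_eq_one]
    rintro ⟨n, hn, h⟩
    rw [← map_pow] at h
    have h1 : v ^ n = 1 := eq_one_of_forall_commute fun g => by
      have h2 := DFunLike.congr_fun h g
      rw [MulAut.conj_apply, MulAut.one_apply, mul_inv_eq_iff_eq_mul] at h2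
      exact h2
    have h2 := @zpow_injective _ _ hv (n : ℤ) 0 (by simpa using h1)
    omega
  have h1 : Function.Injective (zpowersHom _ (MulAut.conj v)) := fun a b hab =>
    injective_zpow_iff_not_isOfFinOrder.2 h hab
  exact ⟨((MonoidHom.ofInjective h1).trans
    (MulEquiv.subgroupCongr (Subgroup.range_zpowersHom _))).symm⟩

end Conclusion

end FreeGroup

theorem statement5 (X : Type) [Fintype X] [DecidableEq X] (hX : 2 ≤ Fintype.card X)
    (w : FreeGroup X) (hw : w ∈ TS' X) (hw1 : w ≠ 1) :
    MulAction.stabilizer (MulAut (FreeGroup X)) w = Subgroup.zpowers (MulAut.conj w⁻¹) ∧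
      Nonempty ((Subgroup.zpowers (MulAut.conj w⁻¹ : MulAut (FreeGroup X))) ≃*
        Multiplicative ℤ) := by
  have : Nontrivial X := Fintype.one_lt_card_iff_nontrivial.1 hX
  refine ⟨?_, FreeGroup.conj_zpowers_mulEquiv (inv_ne_one.2 hw1)⟩
  obtain ⟨g, u, hu, -, rfl, -⟩ := hw
  have hu1 : u ≠ 1 := by
    rintro rfl
    simp at hw1
  rw [FreeGroup.stabilizer_conj, FreeGroup.stabilizer_eq_zpowers hu1 hu, MonoidHom.map_zpowers]
  simp [mul_assoc]
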